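/- arXiv:1208.1509 — 3 statements merged into one kernel-verified Lean document; each statement's English description precedes it below -/
import Mathlib

section
/- Let μ, ν ∈ 𝓜 with μ ≤C ν. Then there exists a unique martingale transport plan π ∈ Π_M(μ,ν) such that for every x ∈ ℝ the second marginal of the restriction of π to (−∞,x]×ℝ equals the shadow S^ν(μ|(−∞,x]) of the restriction of μ to (−∞,x] in ν. (This π is called the left-curtain coupling π_lc.) -/
open MeasureTheory Set Filter Topology

noncomputable section

/-- Convex order of finite measures on `ℝ` with finite first moments. -/
def ConvexOrder (μ ν : MeasureTheory.Measure ℝ) : Prop :=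
  μ Set.univ = ν Set.univ ∧
  (∫ x, x ∂μ) = (∫ x, x ∂ν) ∧
  ∀ k : ℝ, (∫ x, max (x - k) 0 ∂μ) ≤ ∫ x, max (x - k) 0 ∂ν

/-- Extended convex order: integrals of nonnegative convex functions increase. -/
def ExtConvexOrder (μ ν : MeasureTheory.Measure ℝ) : Prop :=
  ∀ φ : ℝ → ℝ, ConvexOn ℝ Set.univ φ → (∀ x, 0 ≤ φ x) →
    (∫⁻ x, ENNReal.ofReal (φ x) ∂μ) ≤ ∫⁻ x, ENNReal.ofReal (φ x) ∂ν

/-- `π` is a transport plan with marginals `μ` and `ν`. -/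
def IsCoupling (μ ν : MeasureTheory.Measure ℝ) (π : MeasureTheory.Measure (ℝ × ℝ)) : Prop :=
  π.map Prod.fst = μ ∧ π.map Prod.snd = ν

/-- `π ∈ Π_M(μ,ν)`: a coupling satisfying the martingale condition. -/
def IsMartingaleCoupling (μ ν : MeasureTheory.Measure ℝ) (π : MeasureTheory.Measure (ℝ × ℝ)) : Prop :=
  IsCoupling μ ν π ∧
  ∀ ρ : ℝ → ℝ, Continuous ρ → (∃ M : ℝ, ∀ x, |ρ x| ≤ M) →
    (∫ p : ℝ × ℝ, ρ p.1 * (p.2 - p.1) ∂π) = 0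

/-- `S` is the shadow `S^ν(μ)` of `μ` in `ν`. -/
def IsShadow (μ ν S : MeasureTheory.Measure ℝ) : Prop :=
  S ≤ ν ∧ ConvexOrder μ S ∧
  ∀ η : MeasureTheory.Measure ℝ, η ≤ ν → ConvexOrder μ η → ConvexOrder S η

/-- `π` is the left-curtain coupling between `μ` and `ν`. -/
def IsLeftCurtain (μ ν : MeasureTheory.Measure ℝ) (π : MeasureTheory.Measure (ℝ × ℝ)) : Prop :=
  IsMartingaleCoupling μ ν π ∧
  ∀ x : ℝ, IsShadow (μ.restrict (Set.Iic x)) ν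
    (MeasureTheory.Measure.map Prod.snd (π.restrict ((Set.Iic x) ×ˢ (Set.univ : Set ℝ))))

/-- `π` is left-monotone. -/
def IsLeftMonotone (π : MeasureTheory.Measure (ℝ × ℝ)) : Prop :=
  ∃ Γ : Set (ℝ × ℝ), MeasurableSet Γ ∧ π Γᶜ = 0 ∧
    ∀ x x' ym yp y' : ℝ, (x, ym) ∈ Γ → (x, yp) ∈ Γ → (x', y') ∈ Γ →
      x < x' → ym < y' → y' < yp → False

/-- The sufficient integrability condition on the cost function. -/
def SuffInt (c : ℝ → ℝ → ℝ) (μ ν : MeasureTheory.Measure ℝ) : Prop :=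
  ∃ a b : ℝ → ℝ, MeasureTheory.Integrable a μ ∧ MeasureTheory.Integrable b ν ∧
    ∀ x y : ℝ, a x + b y ≤ c x y

/-- `π` is an optimal martingale transport plan (with finite cost) for the cost `c`. -/
def IsOptimalMart (c : ℝ → ℝ → ℝ) (μ ν : MeasureTheory.Measure ℝ)
    (π : MeasureTheory.Measure (ℝ × ℝ)) : Prop :=
  IsMartingaleCoupling μ ν π ∧
  MeasureTheory.Integrable (fun p : ℝ × ℝ => c p.1 p.2) π ∧
  ∀ π' : MeasureTheory.Measure (ℝ × ℝ), IsMartingaleCoupling μ ν π' →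
    MeasureTheory.Integrable (fun p : ℝ × ℝ => c p.1 p.2) π' →
    (∫ p : ℝ × ℝ, c p.1 p.2 ∂π) ≤ ∫ p : ℝ × ℝ, c p.1 p.2 ∂π'


def pot (η : Measure ℝ) (k : ℝ) : ℝ := ∫ x, max (x - k) 0 ∂η

theorem int_max {η : Measure ℝ} [IsFiniteMeasure η] (h : Integrable (fun x : ℝ => x) η) (k : ℝ) :
    Integrable (fun x : ℝ => max (x - k) 0) η :=
  (h.sub (integrable_const k)).pos_part

theorem cvx_max (x : ℝ) : ConvexOn ℝ univ (fun k : ℝ => max (x - k) 0) := by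
  refine ConvexOn.sup (f := fun k : ℝ => x - k) (g := fun _ => (0:ℝ)) ?_ (convexOn_const 0 convex_univ)
  refine ⟨convex_univ, fun a _ b _ s t _ _ hst => ?_⟩
  simp only [smul_eq_mul]
  have : x = (s+t)*x := by rw [hst, one_mul]
  nlinarith

theorem pot_convex {η : Measure ℝ} [IsFiniteMeasure η] (h : Integrable (fun x : ℝ => x) η) :
    ConvexOn ℝ univ (pot η) := by
  refine ⟨convex_univ, fun a _ b _ s t hs ht hst => ?_⟩
  simp only [pot, smul_eq_mul]
  rw [← integral_const_mul, ← integral_const_mul,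
    ← integral_add ((int_max h a).const_mul s) ((int_max h b).const_mul t)]
  refine integral_mono (int_max h _) (((int_max h a).const_mul s).add ((int_max h b).const_mul t)) ?_
  intro x
  exact (cvx_max x).2 (mem_univ a) (mem_univ b) hs ht hst

theorem pot_nonneg (η : Measure ℝ) (k : ℝ) : 0 ≤ pot η k :=
  integral_nonneg fun _ => le_max_right _ _

theorem pot_add {η θ : Measure ℝ} [IsFiniteMeasure η] [IsFiniteMeasure θ]
    (h : ∀ k : ℝ, Integrable (fun x : ℝ => max (x - k) 0) η)
    (h' : ∀ k : ℝ, Integrable (fun x : ℝ => max (x - k) 0) θ) (k : ℝ) :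
    pot (η + θ) k = pot η k + pot θ k :=
  integral_add_measure (h k) (h' k)

theorem pot_atTop {η : Measure ℝ} [IsFiniteMeasure η] (h : Integrable (fun x : ℝ => x) η) :
    Tendsto (pot η) atTop (𝓝 0) := by
  have : (0:ℝ) = ∫ x, (0:ℝ) ∂η := by simp
  rw [this]
  refine tendsto_integral_filter_of_dominated_convergence (fun x => |x|) ?_ ?_ h.abs ?_
  · exact Eventually.of_forall fun k => (int_max h k).aestronglyMeasurable
  · filter_upwards [eventually_ge_atTop 0] with k hk
    refine Eventually.of_forall fun x => ?_
    rw [Real.norm_eq_abs, abs_of_nonneg (le_max_right _ _)]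
    exact max_le (by linarith [le_abs_self x]) (abs_nonneg x)
  · refine Eventually.of_forall fun x => ?_
    refine tendsto_const_nhds.congr' ?_
    filter_upwards [eventually_ge_atTop x] with k hk
    rw [max_eq_right (by linarith)]

theorem pot_atBot {η : Measure ℝ} [IsFiniteMeasure η] (h : Integrable (fun x : ℝ => x) η) :
    Tendsto (fun k => pot η k + η.real univ * k) atBot (𝓝 (∫ x, x ∂η)) := by
  have : ∀ k, pot η k + η.real univ * k = ∫ x, (max (x - k) 0 + k) ∂η := by
    intro k
    rw [integral_add (int_max h k) (integrable_const k), integral_const, smul_eq_mul, pot]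
  simp only [this]
  refine tendsto_integral_filter_of_dominated_convergence (fun x => |x|) ?_ ?_ h.abs ?_
  · exact Eventually.of_forall fun k =>
      ((int_max h k).add (integrable_const k)).aestronglyMeasurable
  · filter_upwards [eventually_le_atBot 0] with k hk
    refine Eventually.of_forall fun x => ?_
    rw [Real.norm_eq_abs, abs_le]
    constructor
    · linarith [le_max_left (x-k) 0, neg_abs_le x]
    · rcases max_cases (x-k) 0 with ⟨h1, _⟩ | ⟨h1, _⟩ <;> rw [h1] <;>
        linarith [le_abs_self x, abs_nonneg x]
  · refine Eventually.of_forall fun x => ?_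
    refine tendsto_const_nhds.congr' ?_
    filter_upwards [eventually_le_atBot x] with k hk
    rw [max_eq_left (by linarith)]; ring

theorem pot_deriv {η : Measure ℝ} [IsFiniteMeasure η]
    (h : ∀ k : ℝ, Integrable (fun x : ℝ => max (x - k) 0) η) (k : ℝ) :
    Tendsto (fun n : ℕ => ((n:ℝ)+1) * (pot η k - pot η (k + 1/((n:ℝ)+1)))) atTop
      (𝓝 (η.real (Ioi k))) := by
  have e : ∀ n : ℕ, ((n:ℝ)+1) * (pot η k - pot η (k + 1/((n:ℝ)+1))) =
      ∫ x, ((n:ℝ)+1) * (max (x-k) 0 - max (x - (k + 1/((n:ℝ)+1))) 0) ∂η := by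
    intro n
    rw [integral_const_mul, integral_sub (h _) (h _)]; rfl
  simp only [e]
  have : η.real (Ioi k) = ∫ x, (Ioi k).indicator (fun _ => (1:ℝ)) x ∂η := by
    rw [integral_indicator measurableSet_Ioi]; simp
  rw [this]
  refine tendsto_integral_of_dominated_convergence (fun _ => (1:ℝ)) ?_ (integrable_const 1) ?_ ?_
  · exact fun n => (((h _).sub (h _)).const_mul _).aestronglyMeasurable
  · intro n
    refine Eventually.of_forall fun x => ?_
    have hn : (0:ℝ) < (n:ℝ)+1 := by positivity
    have hn' : (0:ℝ) < 1/((n:ℝ)+1) := by positivity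
    have h1 : max (x-k) 0 - max (x - (k + 1/((n:ℝ)+1))) 0 ≤ 1/((n:ℝ)+1) := by
      have := le_max_left (x - (k + 1/((n:ℝ)+1))) 0
      have := le_max_right (x - (k + 1/((n:ℝ)+1))) 0
      rcases max_cases (x-k) 0 with ⟨h1, _⟩ | ⟨h1, _⟩ <;> rw [h1] <;> linarith
    have h0 : 0 ≤ max (x-k) 0 - max (x - (k + 1/((n:ℝ)+1))) 0 := by
      have := max_le_max_right 0 (show x - (k + 1/((n:ℝ)+1)) ≤ x - k by linarith)
      linarith
    rw [Real.norm_eq_abs, abs_of_nonneg (by positivity)]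
    calc _ ≤ ((n:ℝ)+1) * (1/((n:ℝ)+1)) := by gcongr
      _ = 1 := by field_simp
  · refine Eventually.of_forall fun x => ?_
    by_cases hx : k < x
    · refine tendsto_const_nhds.congr' ?_
      have ht := tendsto_one_div_add_atTop_nhds_zero_nat (𝕜 := ℝ)
      filter_upwards [ht.eventually (gt_mem_nhds (show 0 < x - k by linarith))] with n hn
      have hn0 : (0:ℝ) < (n:ℝ)+1 := by positivity
      rw [indicator_of_mem (by exact hx), max_eq_left (by linarith), max_eq_left (by linarith)]
      field_simp; ring
    · refine tendsto_const_nhds.congr' (Eventually.of_forall fun n => ?_)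
      have hn' : (0:ℝ) < 1/((n:ℝ)+1) := by positivity
      beta_reduce
      rw [indicator_of_notMem (by exact hx), max_eq_right (by linarith), max_eq_right (by linarith)]
      ring

theorem pot_unique {η θ : Measure ℝ} [IsFiniteMeasure η] [IsFiniteMeasure θ]
    (h : ∀ k : ℝ, Integrable (fun x : ℝ => max (x - k) 0) η)
    (h' : ∀ k : ℝ, Integrable (fun x : ℝ => max (x - k) 0) θ)
    (hp : ∀ k, pot η k = pot θ k) : η = θ := by
  have hI : ∀ k, η (Ioi k) = θ (Ioi k) := by
    intro k
    have h1 := pot_deriv h k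
    have h2 := pot_deriv h' k
    simp only [hp] at h1
    exact (measureReal_eq_measureReal_iff).1 (tendsto_nhds_unique h1 h2)
  have hu : η univ = θ univ := by
    have a := tendsto_measure_iUnion_atTop (μ := η) (s := fun n : ℕ => Ioi (-(n:ℝ)))
      (fun a b hab => Ioi_subset_Ioi (by simpa using hab))
    have b := tendsto_measure_iUnion_atTop (μ := θ) (s := fun n : ℕ => Ioi (-(n:ℝ)))
      (fun a b hab => Ioi_subset_Ioi (by simpa using hab))
    have e : (⋃ n : ℕ, Ioi (-(n:ℝ))) = univ := by
      refine eq_univ_of_forall fun x => ?_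
      obtain ⟨n, hn⟩ := exists_nat_gt (-x)
      exact mem_iUnion.2 ⟨n, by simp only [mem_Ioi]; linarith⟩
    rw [e] at a b
    simp only [Function.comp_def, hI] at a b
    exact tendsto_nhds_unique a b
  refine Measure.ext_of_Iic _ _ fun a => ?_
  rw [← compl_Ioi, measure_compl measurableSet_Ioi (measure_ne_top _ _),
    measure_compl measurableSet_Ioi (measure_ne_top _ _), hu, hI]

theorem cvx_cont {f : ℝ → ℝ} (hf : ConvexOn ℝ univ f) : Continuous f :=
  continuousOn_univ.1 (hf.continuousOn isOpen_univ)

theorem subgrad {f : ℝ → ℝ} (hf : ConvexOn ℝ univ f) (z : ℝ) :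
    ∃ s, ∀ k, f z + s * (k - z) ≤ f k := by
  have hz : z ∈ interior (univ : Set ℝ) := by simp
  refine ⟨derivWithin f (Ioi z) z, fun k => ?_⟩
  rcases lt_trichotomy k z with h | h | h
  · have h1 := hf.slope_le_leftDeriv_of_mem_interior (mem_univ k) hz h
    have h2 := h1.trans (hf.leftDeriv_le_rightDeriv_of_mem_interior hz)
    rw [slope_def_field, div_le_iff₀ (by linarith)] at h2
    linarith
  · subst h; simp
  · have h1 := hf.rightDeriv_le_slope_of_mem_interior hz (mem_univ k) h
    rw [slope_def_field, le_div_iff₀ (by linarith)] at h1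
    linarith

theorem cvx_affine (a b c : ℝ) : ConvexOn ℝ univ (fun k : ℝ => a + b * (k - c)) := by
  refine ⟨convex_univ, fun x _ y _ s t _ _ hst => ?_⟩
  simp only [smul_eq_mul]
  have : t = 1 - s := by linarith
  subst this
  apply le_of_eq; ring

theorem affine_near {f g : ℝ → ℝ} (hf : Continuous f) (hg : ConvexOn ℝ univ g)
    (hle : ∀ k, g k ≤ f k)
    (hmax : ∀ c, ConvexOn ℝ univ c → (∀ k, c k ≤ f k) → ∀ k, c k ≤ g k)
    (z : ℝ) (hz : g z < f z) :
    ∃ δ > 0, ∀ ε, 0 < ε → ε ≤ δ → ∃ A B, ∀ k, |k - z| ≤ ε → g k = A + B * (k - z) := by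
  have hgc := cvx_cont hg
  set r := (f z - g z) / 4 with hr
  have hr0 : 0 < r := by rw [hr]; linarith
  obtain ⟨δ₁, h1, H1⟩ := Metric.continuous_iff.1 hf z r hr0
  obtain ⟨δ₂, h2, H2⟩ := Metric.continuous_iff.1 hgc z r hr0
  refine ⟨min δ₁ δ₂ / 2, by positivity, fun ε hε hεδ => ?_⟩
  have e1 : ε < δ₁ := by have := min_le_left δ₁ δ₂; have : 0 < min δ₁ δ₂ := by positivity
                         linarith
  have e2 : ε < δ₂ := by have := min_le_right δ₁ δ₂; have : 0 < min δ₁ δ₂ := by positivity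
                         linarith
  have F : ∀ k, |k - z| ≤ ε → f z - r < f k := fun k hk => by
    have := abs_lt.1 (Real.dist_eq _ _ ▸ H1 k (by rw [Real.dist_eq]; linarith))
    linarith [this.1]
  have G : ∀ k, |k - z| ≤ ε → g k < g z + r := fun k hk => by
    have := abs_lt.1 (Real.dist_eq _ _ ▸ H2 k (by rw [Real.dist_eq]; linarith))
    linarith [this.2]
  set u := z - ε with hu
  set v := z + ε with hv
  set σ := (g v - g u) / (v - u) with hσ
  have huv : 0 < v - u := by rw [hu, hv]; linarith
  have hσ' : σ * (v - u) = g v - g u := by rw [hσ]; field_simp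
  have hout : ∀ k, k < u ∨ v < k → g u + σ * (k - u) ≤ g k := by
    intro k hk
    rcases hk with hk | hk
    · have := hg.secant_mono (mem_univ u) (mem_univ k) (mem_univ v) (by linarith) (by linarith)
        (by linarith)
      rw [← hσ, div_le_iff_of_neg (by linarith)] at this
      linarith
    · have := hg.secant_mono (mem_univ u) (mem_univ v) (mem_univ k) (by linarith) (by linarith)
        (by linarith)
      rw [← hσ, le_div_iff₀ (by linarith)] at this
      linarith
  have hin : ∀ k, u ≤ k → k ≤ v → g k ≤ g u + σ * (k - u) := by
    intro k hk1 hk2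
    rcases hk1.eq_or_lt with rfl | hk1
    · simp
    have := hg.secant_mono (mem_univ u) (mem_univ k) (mem_univ v) (by linarith) (by linarith)
        (by linarith)
    rw [← hσ, div_le_iff₀ (by linarith)] at this
    linarith
  have hc := hmax (fun k => max (g k) (g u + σ * (k - u)))
    (hg.sup (cvx_affine (g u) σ u)) (by
      intro k
      refine max_le (hle k) ?_
      by_cases hk : k < u ∨ v < k
      · exact (hout k hk).trans (hle k)
      · push Not at hk
        have hkz : |k - z| ≤ ε := abs_le.2 ⟨by linarith [hk.1], by linarith [hk.2]⟩
        have h1 := F k hkz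
        have h2 := G u (by rw [hu, abs_le]; constructor <;> linarith)
        have h3 := G v (by rw [hv, abs_le]; constructor <;> linarith)
        have h4 : σ * (k - u) ≤ max 0 (g v - g u) := by
          rcases le_total 0 σ with hs | hs
          · refine le_trans ?_ (le_max_right _ _)
            rw [← hσ']
            exact mul_le_mul_of_nonneg_left (by linarith [hk.2]) hs
          · refine le_trans ?_ (le_max_left _ _)
            exact mul_nonpos_of_nonpos_of_nonneg hs (by linarith [hk.1])
        rcases max_cases 0 (g v - g u) with ⟨h5, _⟩ | ⟨h5, _⟩ <;> rw [h5] at h4 <;> linarith)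
  refine ⟨g u + σ * (z - u), σ, fun k hk => ?_⟩
  have hk := abs_le.1 hk
  have h1 := hin k (by linarith [hk.1]) (by linarith [hk.2])
  have h2 := (le_max_right _ _).trans (hc k)
  linarith

theorem key {h p g : ℝ → ℝ} (hh : ConvexOn ℝ univ h) (hp : ConvexOn ℝ univ p)
    (hg : ConvexOn ℝ univ g) (hle : ∀ k, g k ≤ h k - p k)
    (hmax : ∀ c, ConvexOn ℝ univ c → (∀ k, c k ≤ h k - p k) → ∀ k, c k ≤ g k) :
    ConvexOn ℝ univ (fun k => h k - g k) := by
  have hhc := cvx_cont hh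
  have hpc := cvx_cont hp
  have hgc := cvx_cont hg
  refine LinearOrder.convexOn_of_lt convex_univ fun a _ b _ hab s t hs ht hst => ?_
  simp only [smul_eq_mul]
  by_contra hcon
  push Not at hcon
  set D : ℝ → ℝ := fun k => h k - g k with hD
  set σ := (D b - D a) / (b - a) with hσ
  have hσ' : σ * (b - a) = D b - D a := by rw [hσ]; field_simp [sub_ne_zero.2 hab.ne']
  set E : ℝ → ℝ := fun k => D k - (D a + σ * (k - a)) with hE
  have hEc : Continuous E := by rw [hE, hD]; fun_prop
  have hEa : E a = 0 := by simp [hE]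
  have hEb : E b = 0 := by simp only [hE]; linarith
  set c := s * a + t * b with hc
  have hs' : s = 1 - t := by linarith
  have hEcpos : 0 < E c := by
    have : c - a = t * (b - a) := by rw [hc, hs']; ring
    have h2 : D a + σ * (c - a) = s * D a + t * D b := by
      rw [this, hs']; linear_combination t * hσ'
    simp only [hE]; rw [h2]; simp only [hD]; linarith
  have hcm : c ∈ Icc a b := by
    constructor <;> rw [hc, hs'] <;> nlinarith
  obtain ⟨z0, hz0, hmx⟩ := isCompact_Icc.exists_isMaxOn ⟨c, hcm⟩ hEc.continuousOn
  set M := E z0 with hM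
  have hmx' : ∀ k ∈ Icc a b, E k ≤ M := fun k hk => hmx hk
  have hMpos : 0 < M := hEcpos.trans_le (hmx' c hcm)
  have hcomp : IsCompact (Icc a b ∩ E ⁻¹' {M}) :=
    isCompact_Icc.inter_right (isClosed_singleton.preimage hEc)
  obtain ⟨z, ⟨hzI, hzM⟩, hzl⟩ := hcomp.exists_isLeast ⟨z0, hz0, rfl⟩
  have hzM : E z = M := hzM
  have hza : a < z := lt_of_le_of_ne hzI.1 (by rintro rfl; linarith)
  have hzb : z < b := lt_of_le_of_ne hzI.2 (by rintro rfl; linarith)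
  rcases (hle z).eq_or_lt with heq | hlt
  · obtain ⟨τ, hτ⟩ := subgrad hp z
    have hsup : ∀ k, M + (τ - σ) * (k - z) ≤ E k := by
      intro k
      have h1 := hτ k
      have h2 := hle k
      rw [← hzM]; simp only [hE, hD]; linarith
    have h1 := hsup a
    have h2 := hsup b
    rw [hEa] at h1; rw [hEb] at h2
    rcases le_total 0 (τ - σ) with hq | hq
    · have := mul_nonneg hq (show 0 ≤ b - z by linarith); linarith
    · have := mul_nonneg_of_nonpos_of_nonpos hq (show a - z ≤ 0 by linarith); linarith
  · obtain ⟨δ, hδ, H⟩ := affine_near (f := fun k => h k - p k) (by fun_prop) hg hle hmax z hlt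
    obtain ⟨τ, hτ⟩ := subgrad hh z
    set ε := min δ (min (z - a) (b - z)) with hε
    have hε0 : 0 < ε := by
      rw [hε]; exact lt_min hδ (lt_min (by linarith) (by linarith))
    have hε1 : ε ≤ z - a := (min_le_right _ _).trans (min_le_left _ _)
    have hε2 : ε ≤ b - z := (min_le_right _ _).trans (min_le_right _ _)
    obtain ⟨A, B, hAB⟩ := H ε hε0 (min_le_left _ _)
    have hsup : ∀ k, |k - z| ≤ ε → M + (τ - B - σ) * (k - z) ≤ E k := by
      intro k hk
      have h1 := hτ k
      have h2 := hAB k hk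
      have h3 := hAB z (by simpa using hε0.le)
      rw [← hzM]; simp only [hE, hD]; rw [h2, h3]; linarith
    have h1 := hsup (z - ε) (by rw [abs_le]; constructor <;> linarith)
    have h2 := hsup (z + ε) (by rw [abs_le]; constructor <;> linarith)
    have m1 := hmx' (z - ε) ⟨by linarith, by linarith⟩
    have m2 := hmx' (z + ε) ⟨by linarith, by linarith⟩
    have hne : E (z - ε) = M := by linarith
    have := hzl ⟨⟨by linarith, by linarith⟩, hne⟩
    linarith

def hull (f : ℝ → ℝ) (k : ℝ) : ℝ :=
  sSup {r | ∃ c : ℝ → ℝ, ConvexOn ℝ univ c ∧ (∀ x, c x ≤ f x) ∧ c k = r}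

theorem le_hull {f c : ℝ → ℝ} (hc : ConvexOn ℝ univ c) (hle : ∀ x, c x ≤ f x) (k : ℝ) :
    c k ≤ hull f k :=
  le_csSup ⟨f k, by rintro _ ⟨c, _, h, rfl⟩; exact h k⟩ ⟨c, hc, hle, rfl⟩

theorem hull_le {f c : ℝ → ℝ} (hc : ConvexOn ℝ univ c) (hle : ∀ x, c x ≤ f x) (k : ℝ) :
    hull f k ≤ f k :=
  csSup_le ⟨_, c, hc, hle, rfl⟩ (by rintro _ ⟨c, _, h, rfl⟩; exact h k)

theorem hull_convex {f c : ℝ → ℝ} (hc : ConvexOn ℝ univ c) (hle : ∀ x, c x ≤ f x) :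
    ConvexOn ℝ univ (hull f) := by
  refine ⟨convex_univ, fun a _ b _ s t hs ht hst => ?_⟩
  refine csSup_le ⟨_, c, hc, hle, rfl⟩ ?_
  rintro _ ⟨c, hc, h, rfl⟩
  refine (hc.2 (mem_univ a) (mem_univ b) hs ht hst).trans ?_
  exact add_le_add (mul_le_mul_of_nonneg_left (le_hull hc h a) hs)
    (mul_le_mul_of_nonneg_left (le_hull hc h b) ht)

theorem rep {D : ℝ → ℝ} {M m : ℝ} (hD : ConvexOn ℝ univ D) (hT : Tendsto D atTop (𝓝 0))
    (hB : Tendsto (fun k => D k + M * k) atBot (𝓝 m)) :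
    ∃ S : Measure ℝ, IsFiniteMeasure S ∧ (∀ k : ℝ, Integrable (fun x : ℝ => max (x - k) 0) S) ∧
      (∀ k, pot S k = D k) := by
  have hDc := cvx_cont hD
  have hin : ∀ z : ℝ, z ∈ interior (univ : Set ℝ) := by simp
  set d : ℝ → ℝ := fun k => derivWithin D (Ioi k) k with hd
  have hmono : Monotone d := by
    have := hD.monotoneOn_rightDeriv
    rwa [interior_univ, monotoneOn_univ] at this
  have hup : ∀ k, d k ≤ D (k + 1) - D k := fun k => by
    have := hD.rightDeriv_le_slope_of_mem_interior (hin k) (mem_univ (k+1)) (by linarith)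
    rw [slope_def_field] at this
    simpa using this
  have hlo : ∀ k, D k - D (k - 1) ≤ d k := fun k => by
    have := (hD.slope_le_leftDeriv_of_mem_interior (mem_univ (k-1)) (hin k) (by linarith)).trans
      (hD.leftDeriv_le_rightDeriv_of_mem_interior (hin k))
    rw [slope_def_field] at this
    simpa using this
  set F := hmono.stieltjesFunction with hF
  have hF1 : ∀ k, D k - D (k - 1) ≤ F k := fun k =>
    (hlo k).trans (by rw [hF, hmono.stieltjesFunction_eq]; exact hmono.le_rightLim le_rfl)
  have hF2 : ∀ k, F k ≤ D (k + 1 + 1) - D (k + 1) := fun k =>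
    le_trans (by rw [hF, hmono.stieltjesFunction_eq]; exact hmono.rightLim_le (by linarith)) (hup _)
  have hFT : Tendsto F atTop (𝓝 0) := by
    have a1 : Tendsto (fun k => D k - D (k - 1)) atTop (𝓝 (0 - 0)) :=
      hT.sub (hT.comp (tendsto_atTop_add_const_right _ _ tendsto_id))
    have hc := hT.comp (tendsto_atTop_add_const_right atTop (1:ℝ) tendsto_id)
    have a2 : Tendsto (fun k => D (k + 1 + 1) - D (k + 1)) atTop (𝓝 (0 - 0)) :=
      (hc.comp (tendsto_atTop_add_const_right atTop (1:ℝ) tendsto_id)).sub hc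
    rw [sub_zero] at a1 a2
    exact tendsto_of_tendsto_of_tendsto_of_le_of_le a1 a2 hF1 hF2
  have hFB : Tendsto F atBot (𝓝 (-M)) := by
    have a1 : Tendsto (fun k => D k - D (k - 1)) atBot (𝓝 (m - m - M)) := by
      have := (hB.sub (hB.comp (tendsto_atBot_add_const_right atBot (-1:ℝ) tendsto_id))).sub_const M
      refine this.congr fun k => ?_
      simp only [Function.comp, id, ← sub_eq_add_neg]; ring
    have hc := hB.comp (tendsto_atBot_add_const_right atBot (1:ℝ) tendsto_id)
    have a2 : Tendsto (fun k => D (k + 1 + 1) - D (k + 1)) atBot (𝓝 (m - m - M)) := by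
      have := ((hc.comp (tendsto_atBot_add_const_right atBot (1:ℝ) tendsto_id)).sub hc).sub_const M
      refine this.congr fun k => ?_
      simp only [Function.comp, id]; ring
    rw [sub_self, zero_sub] at a1 a2
    exact tendsto_of_tendsto_of_tendsto_of_le_of_le a1 a2 hF1 hF2
  have hFae : ∀ᵐ t ∂(volume : Measure ℝ), F t = d t := by
    have hcnt := hmono.countable_not_continuousAt
    rw [ae_iff]
    refine measure_mono_null ?_ (hcnt.measure_zero volume)
    intro t ht hct
    refine ht ?_
    rw [hF, hmono.stieltjesFunction_eq]
    exact hct.continuousWithinAt.rightLim_eq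
  have hdneg : ∀ t, d t ≤ 0 := by
    intro t
    refine le_trans ?_ (F.mono.ge_of_tendsto hFT t)
    rw [hF, hmono.stieltjesFunction_eq]; exact hmono.le_rightLim le_rfl
  have hint : ∀ a b, IntervalIntegrable d volume a b := fun a b => hmono.intervalIntegrable
  have hftc : ∀ k b : ℝ, (∫ t in (0:ℝ)..b, -d (k + t)) = D k - D (k + b) := by
    intro k b
    rw [intervalIntegral.integral_neg, intervalIntegral.integral_comp_add_left (fun t => d t) k,
      intervalIntegral.integral_eq_sub_of_hasDeriv_right hDc.continuousOn
        (fun x _ => hD.hasDerivWithinAt_rightDeriv_of_mem_interior (hin x)) (hint _ _)]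
    simp
  have hlim : ∀ k : ℝ, Tendsto (fun n : ℕ => D k - D (k + n)) atTop (𝓝 (D k)) := by
    intro k
    have := tendsto_const_nhds (x := D k) |>.sub (hT.comp
      (tendsto_atTop_add_const_left atTop k (tendsto_natCast_atTop_atTop (R := ℝ))))
    simpa using this
  have hmono' : ∀ k, Antitone (fun t => -d (k + t)) := fun k a b hab =>
    neg_le_neg (hmono (by linarith))
  have hintg : ∀ k : ℝ, IntegrableOn (fun t => -d (k + t)) (Ioi 0) := by
    intro k
    refine integrableOn_Ioi_of_intervalIntegral_norm_tendsto (l := atTop) (ι := ℕ)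
      (b := fun n : ℕ => (n:ℝ)) (D k) 0 ?_
      tendsto_natCast_atTop_atTop ?_
    · intro n
      exact ((hmono' k).intervalIntegrable (a := 0) (b := (n:ℝ))).1
    · refine (hlim k).congr fun n => ?_
      rw [← hftc]
      refine intervalIntegral.integral_congr fun t _ => ?_
      simp only [Real.norm_eq_abs]
      rw [abs_of_nonneg (by linarith [hdneg (k+t)])]
  have hval : ∀ k : ℝ, ∫ t in Ioi (0:ℝ), -d (k + t) = D k := by
    intro k
    have h1 := intervalIntegral_tendsto_integral_Ioi (0:ℝ) (hintg k)
      (tendsto_natCast_atTop_atTop (R := ℝ))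
    simp only [hftc] at h1
    exact tendsto_nhds_unique h1 (hlim k)
  have hfin : F.measure univ = ENNReal.ofReal (0 - (-M)) := F.measure_univ hFB hFT
  have hFM : IsFiniteMeasure F.measure := ⟨by rw [hfin]; exact ENNReal.ofReal_lt_top⟩
  have hnn : ∀ k : ℝ, 0 ≤ᵐ[F.measure] fun x : ℝ => max (x - k) 0 :=
    fun k => Eventually.of_forall fun x => le_max_right _ _
  have hlint : ∀ k : ℝ, ∫⁻ x, ENNReal.ofReal (max (x - k) 0) ∂F.measure = ENNReal.ofReal (D k) := by
    intro k
    rw [lintegral_eq_lintegral_meas_lt F.measure (hnn k)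
      (by fun_prop), ← hval k, ofReal_integral_eq_lintegral_ofReal (hintg k)
      (Eventually.of_forall fun t => by simpa using hdneg (k+t))]
    refine lintegral_congr_ae ?_
    have hsh : ∀ᵐ t ∂(volume : Measure ℝ), F (k + t) = d (k + t) :=
      (measurePreserving_add_left volume k).quasiMeasurePreserving.ae hFae
    filter_upwards [ae_restrict_mem measurableSet_Ioi, ae_restrict_of_ae hsh] with t ht hft
    have : {a : ℝ | t < max (a - k) 0} = Ioi (k + t) := by
      ext a
      have ht' : 0 < t := ht
      simp only [mem_setOf_eq, lt_max_iff, mem_Ioi]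
      constructor
      · rintro (h | h) <;> linarith
      · intro h; left; linarith
    rw [this, F.measure_Ioi hFT, hft, zero_sub]
  have hI : ∀ k : ℝ, Integrable (fun x : ℝ => max (x - k) 0) F.measure := by
    intro k
    refine ⟨by fun_prop, ?_⟩
    rw [hasFiniteIntegral_iff_ofReal (hnn k), hlint]
    exact ENNReal.ofReal_lt_top
  have hD0 : ∀ k, 0 ≤ D k := fun k => by
    rw [← hval k]
    exact integral_nonneg fun t => by simpa using hdneg (k+t)
  refine ⟨F.measure, hFM, hI, fun k => ?_⟩
  rw [pot, integral_eq_lintegral_of_nonneg_ae (hnn k)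
    (hI k).aestronglyMeasurable, hlint, ENNReal.toReal_ofReal (hD0 k)]

theorem exists_pi {μ ν : Measure ℝ} [IsFiniteMeasure μ] [IsFiniteMeasure ν] {S : ℝ → Measure ℝ}
    (hS : ∀ x, S x ≤ ν) (hmono : ∀ x y, x ≤ y → S x ≤ S y)
    (hmass : ∀ x, S x univ = μ (Iic x)) (hμν : μ univ = ν univ) :
    ∃ π : Measure (ℝ × ℝ), IsFiniteMeasure π ∧
      ∀ x B, MeasurableSet B → π (Iic x ×ˢ B) = S x B := by
  have hfin : ∀ x, IsFiniteMeasure (S x) := fun x => isFiniteMeasure_of_le ν (hS x)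
  set r : ℝ → ℝ → ENNReal := fun x => (S x).rnDeriv ν with hr
  have hrm : ∀ x, Measurable (r x) := fun x => Measure.measurable_rnDeriv _ _
  have hrS : ∀ x B, ∫⁻ y in B, r x y ∂ν = S x B := fun x B =>
    Measure.setLIntegral_rnDeriv (Measure.absolutelyContinuous_of_le (hS x)) B
  have hrU : ∀ x, ∫⁻ y, r x y ∂ν = S x univ := fun x => by
    rw [← hrS x univ, Measure.restrict_univ]
  have ha : ∀ᵐ y ∂ν, ∀ q : ℚ, r q y ≤ 1 := by
    rw [ae_all_iff]; intro q; exact Measure.rnDeriv_le_one_of_le (hS q)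
  have hle : ∀ x y, x ≤ y → r x ≤ᵐ[ν] r y := fun x y hxy =>
    ae_le_of_forall_setLIntegral_le_of_sigmaFinite (hrm x) fun s _ _ => by
      rw [hrS, hrS]; exact hmono x y hxy s
  have hb : ∀ᵐ y ∂ν, ∀ q q' : ℚ, q ≤ q' → r q y ≤ r q' y := by
    rw [ae_all_iff]; intro q; rw [ae_all_iff]; intro q'
    by_cases h : q ≤ q'
    · filter_upwards [hle q q' (by exact_mod_cast h)] with y hy _ using hy
    · exact Eventually.of_forall fun y h' => absurd h' h
  have hc : ∀ᵐ y ∂ν, ⨆ n : ℕ, r (n : ℚ) y = 1 := by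
    have h1 : (fun y => ⨆ n : ℕ, r (n : ℚ) y) ≤ᵐ[ν] fun _ => 1 := by
      filter_upwards [ha] with y hy
      exact iSup_le fun n => hy n
    have ht : Tendsto (fun n : ℕ => μ (Iic (n:ℝ))) atTop (𝓝 (μ univ)) :=
      (tendsto_measure_Iic_atTop μ).comp tendsto_natCast_atTop_atTop
    have h2 : ∫⁻ y, 1 ∂ν ≤ ∫⁻ y, ⨆ n : ℕ, r (n : ℚ) y ∂ν := by
      rw [lintegral_one, ← hμν]
      refine le_of_tendsto' ht fun n => ?_
      rw [← hmass, ← hrU]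
      refine lintegral_mono fun y => ?_
      exact le_trans (by simp) (le_iSup (fun n : ℕ => r (n : ℚ) y) n)
    refine ae_eq_of_ae_le_of_lintegral_le h1 ?_ aemeasurable_const h2
    exact ne_top_of_le_ne_top (by simp) (lintegral_mono_ae h1)
  have hinf : ∀ (x : ℕ → ℚ) (f : ℝ → ENNReal) (c : ENNReal), ∫⁻ y, f y ∂ν = c → c ≠ ⊤ → 
      (∀ n, f ≤ᵐ[ν] r (x n)) → Tendsto (fun n => μ (Iic (x n : ℝ))) atTop (𝓝 c) →
      ∀ᵐ y ∂ν, ⨅ n : ℕ, r (x n) y = f y := by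
    intro x f c hfc hct hfx ht
    have h1 : f ≤ᵐ[ν] fun y => ⨅ n : ℕ, r (x n) y := by
      filter_upwards [ae_all_iff.2 hfx] with y hy
      exact le_iInf hy
    have h2 : ∫⁻ y, ⨅ n : ℕ, r (x n) y ∂ν ≤ ∫⁻ y, f y ∂ν := by
      rw [hfc]
      refine ge_of_tendsto' ht fun n => ?_
      rw [← hmass, ← hrU]
      exact lintegral_mono fun y => iInf_le _ n
    have := ae_eq_of_ae_le_of_lintegral_le h1 (by rw [hfc]; exact hct)
      (Measurable.iInf fun n => hrm _).aemeasurable h2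
    filter_upwards [this] with y hy using hy.symm
  have hdd : ∀ᵐ y ∂ν, ⨅ n : ℕ, r ((-(n:ℚ) : ℚ) : ℝ) y = 0 := by
    refine hinf (fun n => -(n:ℚ)) (fun _ => 0) 0 (by simp) (by simp)
      (fun n => Eventually.of_forall fun y => zero_le) ?_
    have := tendsto_measure_iInter_atTop (μ := μ) (s := fun n : ℕ => Iic (-(n:ℝ)))
      (fun n => measurableSet_Iic.nullMeasurableSet)
      (fun a b hab => Iic_subset_Iic.2 (by simpa using hab)) ⟨0, measure_ne_top _ _⟩
    have e : (⋂ n : ℕ, Iic (-(n:ℝ))) = ∅ := by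
      refine eq_empty_of_forall_notMem fun x hx => ?_
      obtain ⟨n, hn⟩ := exists_nat_gt (-x)
      have := mem_iInter.1 hx n
      simp only [mem_Iic] at this; linarith
    rw [e, measure_empty] at this
    simpa [Function.comp_def] using this
  have hrc : ∀ (η : Measure (ℝ × ℝ)) [IsFiniteMeasure η] (B : Set ℝ) (x : ℝ) (u : ℕ → ℝ),
      MeasurableSet B → Antitone u → (∀ n, x ≤ u n) → Tendsto u atTop (𝓝 x) →
      Tendsto (fun n => η (Iic (u n) ×ˢ B)) atTop (𝓝 (η (Iic x ×ˢ B))) := by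
    intro η _ B x u hB hu hx hux
    have := tendsto_measure_iInter_atTop (μ := η) (s := fun n : ℕ => Iic (u n) ×ˢ B)
      (fun n => (measurableSet_Iic.prod hB).nullMeasurableSet)
      (fun a b hab => prod_mono (Iic_subset_Iic.2 (hu hab)) subset_rfl) ⟨0, measure_ne_top _ _⟩
    have e : (⋂ n : ℕ, Iic (u n) ×ˢ B) = Iic x ×ˢ B := by
      ext ⟨a, b⟩
      simp only [mem_iInter, mem_prod, mem_Iic]
      constructor
      · intro h
        exact ⟨ge_of_tendsto' hux fun n => (h n).1, (h 0).2⟩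
      · rintro ⟨h1, h2⟩ n
        exact ⟨h1.trans (hx n), h2⟩
    rwa [e] at this
  have hμrc : ∀ (x : ℝ) (u : ℕ → ℝ), Antitone u → (∀ n, x ≤ u n) → Tendsto u atTop (𝓝 x) →
      Tendsto (fun n => μ (Iic (u n))) atTop (𝓝 (μ (Iic x))) := by
    intro x u hu hx hux
    have := tendsto_measure_iInter_atTop (μ := μ) (s := fun n : ℕ => Iic (u n))
      (fun n => measurableSet_Iic.nullMeasurableSet)
      (fun a b hab => Iic_subset_Iic.2 (hu hab)) ⟨0, measure_ne_top _ _⟩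
    have e : (⋂ n : ℕ, Iic (u n)) = Iic x := by
      ext a
      simp only [mem_iInter, mem_Iic]
      exact ⟨fun h => ge_of_tendsto' hux h, fun h n => h.trans (hx n)⟩
    rwa [e] at this
  have he : ∀ᵐ y ∂ν, ∀ q : ℚ, ⨅ n : ℕ, r ((q + 1 / ((n:ℚ) + 1) : ℚ) : ℝ) y = r q y := by
    rw [ae_all_iff]; intro q
    refine hinf (fun n => q + 1 / ((n:ℚ) + 1)) (r q) (μ (Iic (q:ℝ))) ?_ (measure_ne_top _ _) ?_ ?_
    · rw [hrU, hmass]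
    · intro n
      refine hle _ _ ?_
      have : q ≤ q + 1 / ((n:ℚ) + 1) := by
        have : 0 ≤ 1 / ((n:ℚ) + 1) := by positivity
        linarith
      exact_mod_cast this
    · push_cast
      refine hμrc q _ ?_ ?_ ?_
      · intro a b hab
        simp only
        gcongr
      · intro n
        have : 0 ≤ 1 / ((n:ℝ) + 1) := by positivity
        linarith
      · simpa using (tendsto_one_div_add_atTop_nhds_zero_nat (𝕜 := ℝ)).const_add (q:ℝ)
  set f : ℝ → ℚ → ℝ := fun y q => (r q y).toReal with hf
  have hfm : Measurable f := measurable_pi_iff.2 fun q => (hrm q).ennreal_toReal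
  have hst : ∀ᵐ y ∂ν, ProbabilityTheory.IsRatStieltjesPoint f y := by
    filter_upwards [ha, hb, hc, hdd, he] with y ha hb hc hdd he
    have hne : ∀ q : ℚ, r q y ≠ ⊤ := fun q => ne_top_of_le_ne_top (by simp) (ha q)
    have hm : Monotone (fun q : ℚ => r q y) := fun q q' h => hb q q' h
    refine ⟨fun q q' h => ENNReal.toReal_mono (hne q') (hb q q' h), ?_, ?_, ?_⟩
    · have h1 := tendsto_atTop_iSup hm
      have e : ⨆ q : ℚ, r q y = 1 := by
        refine le_antisymm (iSup_le ha) ?_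
        rw [← hc]
        exact iSup_le fun n => le_iSup (fun q : ℚ => r q y) (n:ℚ)
      rw [e] at h1
      exact (ENNReal.tendsto_toReal (by simp)).comp h1
    · have h1 := tendsto_atBot_iInf hm
      have e : ⨅ q : ℚ, r q y = 0 := by
        refine le_antisymm ?_ zero_le
        rw [← hdd]
        exact le_iInf fun n => iInf_le (fun q : ℚ => r q y) (-(n:ℚ))
      rw [e] at h1
      exact (ENNReal.tendsto_toReal (by simp)).comp h1
    · intro t
      simp only [hf]
      rw [← ENNReal.toReal_iInf (f := fun q : Ioi t => r ((q:ℚ):ℝ) y) (fun q => hne q)]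
      congr 1
      refine le_antisymm ?_ (le_iInf fun q => hb _ _ q.2.le)
      rw [← he t]
      refine le_iInf fun n => ?_
      have hn : t < t + 1 / ((n:ℚ) + 1) := by
        have : 0 < 1 / ((n:ℚ) + 1) := by positivity
        linarith
      exact iInf_le (fun q : Ioi t => r (q:ℚ) y) ⟨_, hn⟩
  set K : ProbabilityTheory.Kernel ℝ ℝ :=
    ⟨fun y => (ProbabilityTheory.stieltjesOfMeasurableRat f hfm y).measure,
      ProbabilityTheory.measurable_measure_stieltjesOfMeasurableRat hfm⟩ with hK
  have hKm : ProbabilityTheory.IsMarkovKernel K :=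
    ⟨fun y => ProbabilityTheory.instIsProbabilityMeasure_stieltjesOfMeasurableRat hfm y⟩
  have hrat : ∀ (q : ℚ) B, MeasurableSet B →
      ((ν.compProd K).map Prod.swap) (Iic (q:ℝ) ×ˢ B) = S q B := by
    intro q B hB
    rw [Measure.map_apply measurable_swap (measurableSet_Iic.prod hB), preimage_swap_prod,
      Measure.compProd_apply_prod hB measurableSet_Iic, ← hrS]
    refine lintegral_congr_ae (ae_restrict_of_ae ?_)
    filter_upwards [hst, ha] with y hy ha
    have : K y (Iic (q:ℝ)) = ENNReal.ofReal (ProbabilityTheory.stieltjesOfMeasurableRat f hfm y q) :=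
      ProbabilityTheory.measure_stieltjesOfMeasurableRat_Iic hfm y q
    rw [this, ProbabilityTheory.stieltjesOfMeasurableRat_eq,
      ProbabilityTheory.toRatCDF_of_isRatStieltjesPoint hy, hf]
    exact ENNReal.ofReal_toReal (ne_top_of_le_ne_top (by simp) (ha q))
  refine ⟨(ν.compProd K).map Prod.swap, inferInstance, fun x B hB => ?_⟩
  obtain ⟨u, hu, hux, hut⟩ := Real.exists_seq_rat_strictAnti_tendsto x
  have hu' : Antitone (fun n => (u n : ℝ)) := fun a b hab =>
    Rat.cast_le.2 (hu.antitone hab)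
  have h1 := hrc ((ν.compProd K).map Prod.swap) B x (fun n => u n) hB hu' (fun n => (hux n).le) hut
  simp only [hrat _ _ hB] at h1
  refine tendsto_nhds_unique h1 ?_
  have h2 := hμrc x (fun n => u n) hu' (fun n => (hux n).le) hut
  have h3 : Tendsto (fun n => S x B + (μ (Iic (u n : ℝ)) - μ (Iic x))) atTop
      (𝓝 (S x B + (μ (Iic x) - μ (Iic x)))) :=
    (ENNReal.Tendsto.sub h2 tendsto_const_nhds (Or.inl (measure_ne_top _ _))).const_add _
  rw [tsub_self, add_zero] at h3
  refine tendsto_of_tendsto_of_tendsto_of_le_of_le tendsto_const_nhds h3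
    (fun n => hmono _ _ (hux n).le B) (fun n => ?_)
  have hc1 : S (u n) Bᶜ ≥ S x Bᶜ := hmono _ _ (hux n).le _
  have e1 := measure_add_measure_compl (μ := S x) hB
  have e2 := measure_add_measure_compl (μ := S (u n)) hB
  rw [← hmass, ← hmass, ← e1, ← e2]
  simp only
  have := measure_ne_top (S x) B
  have := measure_ne_top (S x) Bᶜ
  have := measure_ne_top (S (u n)) B
  have := measure_ne_top (S (u n)) Bᶜ
  have hb1 : S x B ≤ S (u n) B := hmono _ _ (hux n).le _
  rw [← ENNReal.toReal_le_toReal (by assumption) (by finiteness), ENNReal.toReal_add (by assumption) (by finiteness),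
    ENNReal.toReal_sub_of_le (by gcongr) (by finiteness), ENNReal.toReal_add (by assumption) (by assumption),
    ENNReal.toReal_add (by assumption) (by assumption)]
  have := ENNReal.toReal_mono (by assumption) hc1
  linarith

theorem atBot_unique {η : Measure ℝ} [IsFiniteMeasure η] (h : Integrable (fun x : ℝ => x) η)
    {M m : ℝ} (hl : Tendsto (fun k => pot η k + M * k) atBot (𝓝 m)) :
    η.real univ = M ∧ ∫ x, x ∂η = m := by
  have h1 := (pot_atBot h).sub hl
  have h2 := h1.sub (h1.comp (tendsto_atBot_add_const_right atBot (-1:ℝ) tendsto_id))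
  rw [sub_self] at h2
  have h3 : Tendsto (fun _ : ℝ => η.real univ - M) atBot (𝓝 0) := by
    refine h2.congr fun k => ?_
    simp only [Function.comp, id]; ring
  have h4 := tendsto_nhds_unique h3 tendsto_const_nhds
  have h5 : η.real univ = M := by linarith
  refine ⟨h5, ?_⟩
  have h6 := pot_atBot h
  rw [h5] at h6
  exact tendsto_nhds_unique h6 hl

theorem shadow_family {μ ν : Measure ℝ} [IsFiniteMeasure μ] [IsFiniteMeasure ν]
    (hμ : Integrable (fun x : ℝ => x) μ) (hν : Integrable (fun x : ℝ => x) ν)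
    (hord : ConvexOrder μ ν) :
    ∃ S : ℝ → Measure ℝ, (∀ x, IsShadow (μ.restrict (Iic x)) ν (S x)) ∧
      ∀ x y, x ≤ y → S x ≤ S y := by
  obtain ⟨ho1, ho2, ho3⟩ := hord
  have ho3 : ∀ k, pot μ k ≤ pot ν k := ho3
  have hoR : μ.real univ = ν.real univ := by simp only [Measure.real, ho1]
  have hr : ∀ s : Set ℝ, Integrable (fun x : ℝ => x) (μ.restrict s) := fun s => hμ.restrict
  have hsplit : ∀ x k, pot μ k = pot (μ.restrict (Iic x)) k + pot (μ.restrict (Ioi x)) k := by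
    intro x k
    rw [← pot_add (int_max (hr _)) (int_max (hr _)), ← compl_Iic,
      Measure.restrict_add_restrict_compl measurableSet_Iic]
  set f : ℝ → ℝ → ℝ := fun x k => pot ν k - pot (μ.restrict (Iic x)) k with hf
  have hq : ∀ x k, pot (μ.restrict (Ioi x)) k ≤ f x k := by
    intro x k
    simp only [hf]; linarith [ho3 k, hsplit x k]
  set g : ℝ → ℝ → ℝ := fun x => hull (f x) with hg
  have hgc : ∀ x, ConvexOn ℝ univ (g x) := fun x => hull_convex (pot_convex (hr _)) (hq x)
  have hgle : ∀ x k, g x k ≤ f x k := fun x => hull_le (pot_convex (hr _)) (hq x)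
  have hgmax : ∀ x c, ConvexOn ℝ univ c → (∀ k, c k ≤ f x k) → ∀ k, c k ≤ g x k :=
    fun x c h1 h2 => le_hull h1 h2
  have hqg : ∀ x k, pot (μ.restrict (Ioi x)) k ≤ g x k := fun x =>
    hgmax x _ (pot_convex (hr _)) (hq x)
  set D : ℝ → ℝ → ℝ := fun x k => pot ν k - g x k with hD
  have hDc : ∀ x, ConvexOn ℝ univ (D x) := fun x =>
    key (pot_convex hν) (pot_convex (hr (Iic x))) (hgc x) (hgle x) (hgmax x)
  have hD1 : ∀ x k, pot (μ.restrict (Iic x)) k ≤ D x k := by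
    intro x k
    have := hgle x k
    simp only [hD]; simp only [hf] at this; linarith
  have hD2 : ∀ x k, D x k ≤ pot (μ.restrict (Iic x)) k + (pot ν k - pot μ k) := by
    intro x k
    simp only [hD]; linarith [hqg x k, hsplit x k]
  have hDT : ∀ x, Tendsto (D x) atTop (𝓝 0) := by
    intro x
    have h1 := pot_atTop (hr (Iic x))
    have h2 := h1.add ((pot_atTop hν).sub (pot_atTop hμ))
    simp only [sub_zero, add_zero] at h2
    exact tendsto_of_tendsto_of_tendsto_of_le_of_le h1 h2 (hD1 x) (hD2 x)
  set M : ℝ → ℝ := fun x => (μ.restrict (Iic x)).real univ with hM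
  set m : ℝ → ℝ := fun x => ∫ t, t ∂(μ.restrict (Iic x)) with hm
  have hDB : ∀ x, Tendsto (fun k => D x k + M x * k) atBot (𝓝 (m x)) := by
    intro x
    have h1 := pot_atBot (hr (Iic x))
    have h2 := h1.add ((pot_atBot hν).sub (pot_atBot hμ))
    rw [ho2, sub_self, add_zero] at h2
    refine tendsto_of_tendsto_of_tendsto_of_le_of_le h1 h2 (fun k => ?_) (fun k => ?_)
    · simp only [hM]; linarith [hD1 x k]
    · simp only [hM]; rw [hoR]; linarith [hD2 x k]
  choose S hSf hSi hSp using fun x => rep (hDc x) (hDT x) (hDB x)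
  have hadd : ∀ (x : ℝ) (η θ : Measure ℝ) (_ : IsFiniteMeasure η) (_ : IsFiniteMeasure θ)
      (_ : ∀ k : ℝ, Integrable (fun x : ℝ => max (x - k) 0) θ) (M' m' : ℝ) (d : ℝ → ℝ),
      (∀ k : ℝ, Integrable (fun x : ℝ => max (x - k) 0) η) → ConvexOn ℝ univ d →
      (∀ k, d k = pot θ k - pot η k) → Tendsto d atTop (𝓝 0) →
      Tendsto (fun k => d k + M' * k) atBot (𝓝 m') → η ≤ θ := by
    intro x η θ _ _ hθi M' m' d hηi hdc hd ht hb
    obtain ⟨T, hTf, hTi, hTp⟩ := rep hdc ht hb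
    have : η + T = θ := by
      refine pot_unique (fun k => (hηi k).add_measure (hTi k)) hθi fun k => ?_
      rw [pot_add hηi hTi, hTp, hd]; ring
    rw [← this]
    exact Measure.le_add_right le_rfl
  have hSν : ∀ x, S x ≤ ν := by
    intro x
    refine hadd x (S x) ν (hSf x) inferInstance (int_max hν) (ν.real univ - M x)
      (∫ t, t ∂ν - m x) (g x) (hSi x) (hgc x) (fun k => ?_) ?_ ?_
    · rw [hSp]; simp only [hD]; ring
    · have := (pot_atTop hν).sub (hDT x)
      rw [sub_zero] at this
      refine this.congr fun k => ?_
      simp only [hD]; ring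
    · refine ((pot_atBot hν).sub (hDB x)).congr fun k => ?_
      simp only [hD]; ring
  refine ⟨S, fun x => ?_, fun x y hxy => ?_⟩
  · have := hSf x
    have hSint : Integrable (fun t : ℝ => t) (S x) := hν.mono_measure (hSν x)
    obtain ⟨e1, e2⟩ := atBot_unique hSint (M := M x) (m := m x)
      ((hDB x).congr fun k => by rw [hSp])
    have e1' : μ.restrict (Iic x) univ = S x univ :=
      ((measureReal_eq_measureReal_iff).1 e1).symm
    refine ⟨hSν x, ⟨e1', e2.symm, fun k => ?_⟩, fun η hη hηo => ?_⟩
    · change pot (μ.restrict (Iic x)) k ≤ pot (S x) k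
      rw [hSp]; exact hD1 x k
    · obtain ⟨o1, o2, o3⟩ := hηo
      refine ⟨e1'.symm.trans o1, e2.trans o2, fun k => ?_⟩
      change pot (S x) k ≤ pot η k
      have hηf : IsFiniteMeasure η := isFiniteMeasure_of_le ν hη
      have hηi : Integrable (fun t : ℝ => t) η := hν.mono_measure hη
      have hsi : Integrable (fun t : ℝ => t) (ν - η) := hν.mono_measure Measure.sub_le
      have hs : ∀ k, pot ν k = pot (ν - η) k + pot η k := fun k => by
        rw [← pot_add (int_max hsi) (int_max hηi), Measure.sub_add_cancel_of_le hη]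
      have := hgmax x (pot (ν - η)) (pot_convex hsi) (fun k => by
        have : pot (μ.restrict (Iic x)) k ≤ pot η k := o3 k
        simp only [hf]; linarith [hs k]) k
      rw [hSp]; simp only [hD]; linarith [hs k]
  · have hp : ∀ k, pot (μ.restrict (Iic y)) k =
        pot (μ.restrict (Iic x)) k + pot (μ.restrict (Ioc x y)) k := by
      intro k
      rw [← pot_add (int_max (hr _)) (int_max (hr _)), ← Iic_union_Ioc_eq_Iic hxy,
        Measure.restrict_union (Iic_disjoint_Ioc le_rfl) measurableSet_Ioc]
    have hle : ∀ k, g y k ≤ g x k - pot (μ.restrict (Ioc x y)) k := by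
      intro k
      have := hgmax x (fun k => g y k + pot (μ.restrict (Ioc x y)) k)
        ((hgc y).add (pot_convex (hr _))) (fun k => by
          have := hgle y k
          simp only [hf] at this ⊢; linarith [hp k]) k
      linarith
    have hcv := key (hgc x) (pot_convex (hr (Ioc x y))) (hgc y) hle (fun c hc hck =>
      hgmax y c hc fun k => by
        have h1 := hck k
        have h2 := hgle x k
        simp only [hf] at h2 ⊢; linarith [hp k])
    refine hadd x (S x) (S y) (hSf x) (hSf y) (hSi y) (M y - M x) (m y - m x) _ (hSi x) hcv
      (fun k => ?_) ?_ ?_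
    · rw [hSp, hSp]; simp only [hD]; ring
    · have := (hDT y).sub (hDT x)
      rw [sub_zero] at this
      refine this.congr fun k => ?_
      simp only [hD]; ring
    · refine ((hDB y).sub (hDB x)).congr fun k => ?_
      simp only [hD]; ring

theorem shadow_unique {μ ν S T : Measure ℝ} [IsFiniteMeasure ν]
    (hν : Integrable (fun x : ℝ => x) ν) (hS : IsShadow μ ν S) (hT : IsShadow μ ν T) : S = T := by
  have : IsFiniteMeasure S := isFiniteMeasure_of_le ν hS.1
  have : IsFiniteMeasure T := isFiniteMeasure_of_le ν hT.1
  refine pot_unique (int_max (hν.mono_measure hS.1)) (int_max (hν.mono_measure hT.1)) fun k => ?_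
  exact le_antisymm ((hS.2.2 T hT.1 hT.2.1).2.2 k) ((hT.2.2 S hS.1 hS.2.1).2.2 k)

theorem snd_restrict_apply (π : Measure (ℝ × ℝ)) (x : ℝ) {B : Set ℝ} (hB : MeasurableSet B) :
    (π.restrict (Iic x ×ˢ (univ : Set ℝ))).map Prod.snd B = π (Iic x ×ˢ B) := by
  rw [Measure.map_apply measurable_snd hB, Measure.restrict_apply (measurable_snd hB)]
  congr 1
  ext ⟨a, b⟩
  simp [and_comm]

theorem measure_ext_rect {π π' : Measure (ℝ × ℝ)} [IsFiniteMeasure π] 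
    (h : ∀ x B, MeasurableSet B → π (Iic x ×ˢ B) = π' (Iic x ×ˢ B))
    (hfst : π.map Prod.fst = π'.map Prod.fst) : π = π' := by
  have hu : π univ = π' univ := by
    have := congrArg (fun m : Measure ℝ => m univ) hfst
    simpa [Measure.map_apply measurable_fst MeasurableSet.univ] using this
  refine ext_of_generate_finite (image2 (· ×ˢ ·) (range (Iic : ℝ → Set ℝ)) {s | MeasurableSet s})
    ?_ ?_ ?_ hu
  · have hsp : IsCountablySpanning (range (Iic : ℝ → Set ℝ)) := by
      refine ⟨fun n : ℕ => Iic (n:ℝ), fun n => mem_range_self _, ?_⟩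
      refine eq_univ_of_forall fun x => ?_
      obtain ⟨n, hn⟩ := exists_nat_ge x
      exact mem_iUnion.2 ⟨n, hn⟩
    have := generateFrom_eq_prod (α := ℝ) (β := ℝ) (C := range (Iic : ℝ → Set ℝ))
      (D := {s | MeasurableSet s}) (by rw [← borel_eq_generateFrom_Iic, BorelSpace.measurable_eq (α := ℝ)])
      MeasurableSpace.generateFrom_measurableSet hsp isCountablySpanning_measurableSet
    exact this.symm
  · exact isPiSystem_Iic.prod MeasurableSpace.isPiSystem_measurableSet
  · rintro _ ⟨_, ⟨x, rfl⟩, B, hB, rfl⟩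
    exact h x B hB

theorem mart_of {π : Measure (ℝ × ℝ)} [IsFiniteMeasure π]
    (h1 : Integrable (fun p : ℝ × ℝ => p.1) π) (h2 : Integrable (fun p : ℝ × ℝ => p.2) π)
    (h : ∀ x : ℝ, ∫ p in Iic x ×ˢ univ, (p.2 - p.1) ∂π = 0)
    (ρ : ℝ → ℝ) (hρ : Continuous ρ) (hb : ∃ M : ℝ, ∀ x, |ρ x| ≤ M) :
    ∫ p, ρ p.1 * (p.2 - p.1) ∂π = 0 := by
  obtain ⟨C, hC⟩ := hb
  set u : ℝ × ℝ → ℝ := fun p => p.2 - p.1 with hu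
  have hum : Measurable u := by fun_prop
  have hui : Integrable u π := h2.sub h1
  set a : ℝ × ℝ → NNReal := fun p => (u p).toNNReal with ha
  set b : ℝ × ℝ → NNReal := fun p => (-u p).toNNReal with hbdef
  have ham : Measurable a := hum.real_toNNReal
  have hbm : Measurable b := hum.neg.real_toNNReal
  have hai : Integrable (fun p => (a p : ℝ)) π := hui.real_toNNReal
  have hbi : Integrable (fun p => (b p : ℝ)) π := hui.neg.real_toNNReal
  have hab : ∀ p, u p = (a p : ℝ) - b p := fun p => by
    simp only [ha, hbdef, Real.coe_toNNReal']
    rcases max_cases (u p) 0 with ⟨h, _⟩ | ⟨h, _⟩ <;> rcases max_cases (-u p) 0 with ⟨h', _⟩ | ⟨h', _⟩ <;>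
      rw [h, h'] <;> linarith
  set α := (π.withDensity fun p => (a p : ENNReal)).map Prod.fst with hα
  set β := (π.withDensity fun p => (b p : ENNReal)).map Prod.fst with hβ
  have hlin : ∀ (c : ℝ × ℝ → NNReal), Integrable (fun p => (c p : ℝ)) π → ∀ s,
      ∫⁻ p in s, (c p : ENNReal) ∂π = ENNReal.ofReal (∫ p in s, (c p : ℝ) ∂π) := by
    intro c hc s
    rw [ofReal_integral_eq_lintegral_ofReal hc.restrict (Eventually.of_forall fun p => (c p).2)]
    simp
  have hfin : ∀ (c : ℝ × ℝ → NNReal), Integrable (fun p => (c p : ℝ)) π →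
      IsFiniteMeasure (π.withDensity fun p => (c p : ENNReal)) := by
    intro c hc
    refine isFiniteMeasure_withDensity ?_
    rw [← Measure.restrict_univ (μ := π), hlin c hc]
    exact ENNReal.ofReal_ne_top
  have := hfin a hai
  have := hfin b hbi
  have hαβ : α = β := by
    refine Measure.ext_of_Iic _ _ fun x => ?_
    have e : (Prod.fst ⁻¹' Iic x : Set (ℝ × ℝ)) = Iic x ×ˢ univ := by ext; simp
    have hms : MeasurableSet (Iic x ×ˢ (univ : Set ℝ)) := measurableSet_Iic.prod MeasurableSet.univ
    rw [hα, hβ, Measure.map_apply measurable_fst measurableSet_Iic,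
      Measure.map_apply measurable_fst measurableSet_Iic, e, withDensity_apply _ hms,
      withDensity_apply _ hms, hlin a hai, hlin b hbi]
    congr 1
    have := h x
    have h' : ∫ p in Iic x ×ˢ univ, ((a p : ℝ) - b p) ∂π = 0 := by
      rw [← this]; exact integral_congr_ae (Eventually.of_forall fun p => (hab p).symm)
    rw [integral_sub hai.restrict hbi.restrict] at h'
    linarith
  have hint : ∀ (c : ℝ × ℝ → NNReal), Measurable c →
      ∫ x, ρ x ∂((π.withDensity fun p => (c p : ENNReal)).map Prod.fst) = ∫ p, (c p : ℝ) * ρ p.1 ∂π := by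
    intro c hc
    rw [integral_map measurable_fst.aemeasurable hρ.aestronglyMeasurable,
      integral_withDensity_eq_integral_smul hc]
    rfl
  have hpi : ∀ (c : ℝ × ℝ → NNReal), Integrable (fun p => (c p : ℝ)) π →
      Integrable (fun p => (c p : ℝ) * ρ p.1) π := fun c hc =>
    hc.mul_bdd (c := C) (hρ.comp continuous_fst).aestronglyMeasurable
      (Eventually.of_forall fun p => hC p.1)
  have e1 := hint a ham
  have e2 := hint b hbm
  rw [← hα] at e1; rw [← hβ, ← hαβ] at e2
  have : ∫ p, ρ p.1 * u p ∂π = ∫ p, ((a p : ℝ) * ρ p.1 - (b p : ℝ) * ρ p.1) ∂π := by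
    refine integral_congr_ae (Eventually.of_forall fun p => ?_)
    simp only; rw [hab p]; ring
  rw [this, integral_sub (hpi a hai) (hpi b hbi), ← e1, ← e2, sub_self]

theorem fst_finite {μ : Measure ℝ} [IsFiniteMeasure μ] {π : Measure (ℝ × ℝ)}
    (h : π.map Prod.fst = μ) : IsFiniteMeasure π := by
  refine ⟨?_⟩
  have := congrArg (fun m : Measure ℝ => m univ) h
  simp only [Measure.map_apply measurable_fst MeasurableSet.univ, preimage_univ] at this
  rw [this]; exact measure_lt_top _ _

/-- existence and uniqueness of the left-curtain coupling. -/
theorem leftCurtain_exists_unique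
    (μ ν : MeasureTheory.Measure ℝ)
    [MeasureTheory.IsFiniteMeasure μ] [MeasureTheory.IsFiniteMeasure ν]
    (hμ : MeasureTheory.Integrable (fun x : ℝ => x) μ)
    (hν : MeasureTheory.Integrable (fun x : ℝ => x) ν)
    (hord : ConvexOrder μ ν) :
    ∃! π : MeasureTheory.Measure (ℝ × ℝ), IsLeftCurtain μ ν π := by
  obtain ⟨S, hS, hmono⟩ := shadow_family hμ hν hord
  have hmass : ∀ x, S x univ = μ (Iic x) := fun x => by
    rw [← (hS x).2.1.1]; simp
  obtain ⟨π, hπf, hπ⟩ := exists_pi (fun x => (hS x).1) hmono hmass hord.1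
  have hmarg : ∀ x, (π.restrict (Iic x ×ˢ (univ : Set ℝ))).map Prod.snd = S x := fun x =>
    Measure.ext fun B hB => by rw [snd_restrict_apply π x hB, hπ x B hB]
  have hfst : π.map Prod.fst = μ := by
    refine Measure.ext_of_Iic _ _ fun x => ?_
    rw [Measure.map_apply measurable_fst measurableSet_Iic, ← hmass, ← hπ x univ MeasurableSet.univ]
    congr 1
    ext; simp
  have hsndle : π.map Prod.snd ≤ ν := by
    refine Measure.le_iff.2 fun B hB => ?_
    have ht := tendsto_measure_iUnion_atTop (μ := π) (s := fun n : ℕ => Iic (n:ℝ) ×ˢ B)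
      (fun a b hab => prod_mono (Iic_subset_Iic.2 (by simpa using hab)) subset_rfl)
    have e : (⋃ n : ℕ, Iic (n:ℝ) ×ˢ B) = Prod.snd ⁻¹' B := by
      ext ⟨a, b⟩
      simp only [mem_iUnion, mem_prod, mem_Iic, mem_preimage]
      refine ⟨fun ⟨n, h⟩ => h.2, fun h => ?_⟩
      obtain ⟨n, hn⟩ := exists_nat_ge a
      exact ⟨n, hn, h⟩
    rw [e] at ht
    rw [Measure.map_apply measurable_snd hB]
    refine le_of_tendsto' ht fun n => ?_
    simp only [Function.comp]
    rw [hπ _ B hB]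
    exact (hS n).1 B
  have hsnd : π.map Prod.snd = ν := by
    refine Measure.eq_of_le_of_measure_univ_eq hsndle ?_
    rw [Measure.map_apply measurable_snd MeasurableSet.univ, ← hord.1, ← hfst,
      Measure.map_apply measurable_fst MeasurableSet.univ]
    rfl
  have i1 : Integrable (fun p : ℝ × ℝ => p.1) π := by
    have : Integrable (fun x : ℝ => x) (π.map Prod.fst) := by rw [hfst]; exact hμ
    exact this.comp_measurable measurable_fst
  have i2 : Integrable (fun p : ℝ × ℝ => p.2) π := by
    have : Integrable (fun x : ℝ => x) (π.map Prod.snd) := by rw [hsnd]; exact hν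
    exact this.comp_measurable measurable_snd
  refine ⟨π, ⟨⟨⟨hfst, hsnd⟩, mart_of i1 i2 fun x => ?_⟩, fun x => ?_⟩, ?_⟩
  · rw [integral_sub i2.restrict i1.restrict]
    have e2 : ∫ p in Iic x ×ˢ univ, p.2 ∂π = ∫ t, t ∂(S x) := by
      rw [← hmarg x, integral_map measurable_snd.aemeasurable (by fun_prop)]
    have e1 : ∫ p in Iic x ×ˢ univ, p.1 ∂π = ∫ t, t ∂(μ.restrict (Iic x)) := by
      rw [← hfst, Measure.restrict_map measurable_fst measurableSet_Iic,
        integral_map measurable_fst.aemeasurable (by fun_prop)]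
      have : (Prod.fst ⁻¹' Iic x : Set (ℝ × ℝ)) = Iic x ×ˢ univ := by ext; simp
      rw [this]
    rw [e1, e2, (hS x).2.1.2.1, sub_self]
  · rw [hmarg x]; exact hS x
  · intro π' hπ'
    have hf' := hπ'.1.1.1
    have : IsFiniteMeasure π' := fst_finite hf'
    refine measure_ext_rect (fun x B hB => ?_) (hf'.trans hfst.symm)
    rw [hπ x B hB, ← snd_restrict_apply π' x hB, shadow_unique hν (hπ'.2 x) (hS x)]
end
end

section
/- Let μ, ν ∈ 𝓜 with μ ≤C ν, and let π ∈ Π_M(μ,ν) be the left-curtain coupling, i.e. for every t ∈ ℝ the second marginal of the restriction of π to (−∞,t]×ℝ equals the shadow S^ν(μ|(−∞,t]). Then π is left-monotone. -/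
open MeasureTheory Set Filter Topology

noncomputable section

/-- indicator of the left half plane -/
def iA (t : ℝ) (z : ℝ × ℝ) : ℝ := if z.1 ≤ t then 1 else 0

lemma iA_meas (t : ℝ) : Measurable (iA t) :=
  Measurable.ite (measurableSet_le measurable_fst measurable_const) measurable_const measurable_const

lemma int_bdd {π : Measure (ℝ × ℝ)} {f g : ℝ × ℝ → ℝ} (C : ℝ) (hf : Integrable f π)
    (hg : Measurable g) (hb : ∀ z, |g z| ≤ C) : Integrable (fun z => g z * f z) π :=
  hf.bdd_mul hg.aestronglyMeasurable (Eventually.of_forall hb)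

lemma exists_cond (π : Measure (ℝ × ℝ)) [IsFiniteMeasure π] (f : ℝ × ℝ → ℝ) (hf : Integrable f π)
    (hm : Measurable f) (h0 : ∀ z, 0 ≤ f z) :
    ∃ p : ℝ → ℝ, Measurable p ∧ (∀ x, 0 ≤ p x) ∧
      ∀ (h : ℝ → ℝ) (C : ℝ), Measurable h → (∀ x, |h x| ≤ C) →
        ∫ z, h z.1 * f z ∂π = ∫ x, h x * p x ∂π.fst := by
  refine ⟨fun x => ∫ y, f (x, y) ∂π.condKernel x, ?_, ?_, ?_⟩
  · exact (hm.stronglyMeasurable.integral_kernel_prod_right').measurable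
  · intro x
    exact integral_nonneg (fun y => h0 _)
  · intro h C hh hb
    have hi : Integrable (fun z : ℝ × ℝ => h z.1 * f z) π :=
      int_bdd C hf (hh.comp measurable_fst) (fun z => hb _)
    rw [← Measure.integral_condKernel hi]
    congr 1; ext x
    simp only
    rw [integral_const_mul]

set_option maxHeartbeats 2000000 in
lemma core (π : Measure (ℝ × ℝ)) [IsFiniteMeasure π]
    (hX : Integrable (fun z : ℝ × ℝ => z.1) π) (hY : Integrable (fun z : ℝ × ℝ => z.2) π)
    (H1 : ∀ t, ∫ z, iA t z * z.2 ∂π = ∫ z, iA t z * z.1 ∂π)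
    (t : ℝ)
    (H2 : ∀ g : ℝ × ℝ → ℝ, Measurable g → (∀ z, 0 ≤ g z) → (∀ z, g z ≤ 1) →
      ∫ z, g z ∂π = ∫ z, iA t z ∂π → ∫ z, g z * z.2 ∂π = ∫ z, iA t z * z.1 ∂π →
      (∀ k, ∫ z, iA t z * max (z.1 - k) 0 ∂π ≤ ∫ z, g z * max (z.2 - k) 0 ∂π) →
      ∀ k, ∫ z, iA t z * max (z.2 - k) 0 ∂π ≤ ∫ z, g z * max (z.2 - k) 0 ∂π)
    (a b : ℝ) (hab : a < b)
    (hT : π (Ioi t ×ˢ Ioo a b) ≠ 0) :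
    ∃ p : ℝ → ℝ, ∀ᵐ z ∂π, (z.2 < (a:ℝ) → p z.1 ≠ 0) ∧ (z.1 ≤ t → b < z.2 → p z.1 = 0) := by
  set B : Set (ℝ × ℝ) := Ioi t ×ˢ Ioo a b with hB
  have hBm : MeasurableSet B := measurableSet_Ioi.prod measurableSet_Ioo
  set iB : ℝ × ℝ → ℝ := B.indicator (fun _ => 1) with hiB
  have iBm : Measurable iB := measurable_const.indicator hBm
  have iB0 : ∀ z, 0 ≤ iB z := fun z => Set.indicator_nonneg (fun _ _ => zero_le_one) z
  have iB1 : ∀ z, iB z ≤ 1 := fun z => Set.indicator_le_self' (f := fun _ => (1:ℝ)) (fun _ _ => zero_le_one) z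
  have iBb : ∀ z, |iB z| ≤ 1 := fun z => abs_le.2 ⟨by linarith [iB0 z], iB1 z⟩
  have iBdef : ∀ z, iB z = if z ∈ B then 1 else 0 := fun z => by simp [hiB, Set.indicator]
  have iA0 : ∀ t z, 0 ≤ iA t z := fun t z => by unfold iA; split_ifs <;> norm_num
  have iA1 : ∀ t z, iA t z ≤ 1 := fun t z => by unfold iA; split_ifs <;> norm_num
  have iAb : ∀ t z, |iA t z| ≤ 1 := fun t z => abs_le.2 ⟨by linarith [iA0 t z], iA1 t z⟩
  have i1 : Integrable (fun _ : ℝ × ℝ => (1:ℝ)) π := integrable_const _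
  have iiB : Integrable iB π := by simpa using int_bdd 1 i1 iBm iBb
  have iiBY : Integrable (fun z => iB z * z.2) π := int_bdd 1 hY iBm iBb
  set T : ℝ := ∫ z, iB z ∂π with hTdef
  have hTr : T = π.real B := by
    rw [hTdef, hiB, integral_indicator hBm]; simp
  have hTpos : 0 < T := by
    rw [hTr]; exact ENNReal.toReal_pos hT (measure_ne_top _ _)
  set c : ℝ := (∫ z, iB z * z.2 ∂π) / T with hc
  have hcT : ∫ z, iB z * z.2 ∂π = c * T := by rw [hc]; field_simp
  have hac : a ≤ c := by
    rw [hc, le_div_iff₀ hTpos, hTdef, ← integral_const_mul]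
    refine integral_mono (iiB.const_mul a) iiBY fun z => ?_
    simp only [iBdef]; split_ifs with h
    · have := h.2.1; simp; linarith
    · simp
  have hcb : c ≤ b := by
    rw [hc, div_le_iff₀ hTpos, hTdef, ← integral_const_mul]
    refine integral_mono iiBY (iiB.const_mul b) fun z => ?_
    simp only [iBdef]; split_ifs with h
    · have := h.2.2; simp; linarith
    · simp
  set l : ℝ × ℝ → ℝ := fun z => if z.2 < a then 1 else 0 with hl
  set u : ℝ × ℝ → ℝ := fun z => if b < z.2 then 1 else 0 with hu
  have lm : Measurable l := Measurable.ite (measurableSet_lt measurable_snd measurable_const) measurable_const measurable_const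
  have um : Measurable u := Measurable.ite (measurableSet_lt measurable_const measurable_snd) measurable_const measurable_const
  have lb : ∀ z, |l z| ≤ 1 := fun z => by simp only [hl]; split_ifs <;> simp
  have ub : ∀ z, |u z| ≤ 1 := fun z => by simp only [hu]; split_ifs <;> simp
  have icY : Integrable (fun z : ℝ × ℝ => c - z.2) π := (integrable_const c).sub hY
  have iYc : Integrable (fun z : ℝ × ℝ => z.2 - c) π := hY.sub (integrable_const c)
  have if1 : Integrable (fun z => l z * (c - z.2)) π := int_bdd 1 icY lm lb
  have if2 : Integrable (fun z => u z * (z.2 - c)) π := int_bdd 1 iYc um ub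
  have f10 : ∀ z, 0 ≤ l z * (c - z.2) := fun z => by
    simp only [hl]; split_ifs with h <;> simp; linarith
  have f20 : ∀ z, 0 ≤ u z * (z.2 - c) := fun z => by
    simp only [hu]; split_ifs with h <;> simp; linarith
  have mf1 : Measurable (fun z : ℝ × ℝ => l z * (c - z.2)) := by fun_prop
  have mf2 : Measurable (fun z : ℝ × ℝ => u z * (z.2 - c)) := by fun_prop
  obtain ⟨p, pm, p0, hp⟩ := exists_cond π _ if1 mf1 f10
  obtain ⟨q, qm, q0, hq⟩ := exists_cond π _ if2 mf2 f20
  -- vanishing sets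
  have van : ∀ (p : ℝ → ℝ) (f : ℝ × ℝ → ℝ), Measurable p → Integrable f π → (∀ z, 0 ≤ f z) →
      (∀ (h : ℝ → ℝ) (C : ℝ), Measurable h → (∀ x, |h x| ≤ C) →
        ∫ z, h z.1 * f z ∂π = ∫ x, h x * p x ∂π.fst) →
      ∀ᵐ z ∂π, p z.1 = 0 → f z = 0 := by
    intro p f pm hf f0 hp
    set h : ℝ → ℝ := fun x => if p x = 0 then 1 else 0 with hh
    have hm : Measurable h := Measurable.ite (pm (measurableSet_singleton 0)) measurable_const measurable_const
    have hb : ∀ x, |h x| ≤ 1 := fun z => by simp only [hh]; split_ifs <;> simp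
    have h0 : ∀ x, 0 ≤ h x := fun z => by simp only [hh]; split_ifs <;> simp
    have e := hp h 1 hm hb
    have e2 : ∀ x, h x * p x = 0 := fun x => by simp only [hh]; split_ifs with h <;> simp [h]
    simp only [e2, integral_zero] at e
    rw [integral_eq_zero_iff_of_nonneg (fun z => mul_nonneg (h0 _) (f0 z))
      (int_bdd 1 hf (hm.comp measurable_fst) (fun z => hb _))] at e
    filter_upwards [e] with z hz hpz
    simpa [hh, hpz] using hz
  have v1 := van p _ pm if1 f10 hp
  have v2 := van q _ qm if2 f20 hq
  set P : ℝ := ∫ _z, (1:ℝ) ∂π with hP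
  have hP0 : 0 ≤ P := integral_nonneg (fun _ => zero_le_one)
  set ε : ℝ := T / (T + P) with hε
  have ε0 : 0 < ε := by positivity
  have ε1 : ε ≤ 1 := by rw [hε, div_le_one (by positivity)]; linarith
  have εP : ε * P ≤ T := by
    rw [hε, div_mul_eq_mul_div, div_le_iff₀ (by positivity)]; nlinarith
  set r1 : ℝ → ℝ := fun x => q x / (1 + p x + q x) with hr1
  set r2 : ℝ → ℝ := fun x => p x / (1 + p x + q x) with hr2
  have hden : ∀ x, 0 < 1 + p x + q x := fun x => by linarith [p0 x, q0 x]
  have r1m : Measurable r1 := by fun_prop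
  have r2m : Measurable r2 := by fun_prop
  have r10 : ∀ x, 0 ≤ r1 x := fun x => div_nonneg (q0 x) (hden x).le
  have r20 : ∀ x, 0 ≤ r2 x := fun x => div_nonneg (p0 x) (hden x).le
  have r11 : ∀ x, r1 x ≤ 1 := fun x => by
    simp only [hr1]; rw [div_le_one (hden x)]; linarith [p0 x]
  have r21 : ∀ x, r2 x ≤ 1 := fun x => by
    simp only [hr2]; rw [div_le_one (hden x)]; linarith [q0 x]
  have r12 : ∀ x, r1 x * p x = r2 x * q x := fun x => by
    simp only [hr1, hr2]; ring
  set w : ℝ × ℝ → ℝ := fun z => ε * (r1 z.1 * l z + r2 z.1 * u z) with hw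
  have wm : Measurable w := by fun_prop
  have w0 : ∀ z, 0 ≤ w z := fun z => by
    have := r10 z.1; have := r20 z.1
    simp only [hw, hl, hu]; split_ifs <;> simp <;> positivity
  have wε : ∀ z, w z ≤ ε := fun z => by
    have := r11 z.1; have := r21 z.1
    simp only [hw, hl, hu]
    refine mul_le_of_le_one_right ε0.le ?_
    split_ifs
    · linarith
    all_goals simp <;> linarith
  have w1 : ∀ z, w z ≤ 1 := fun z => (wε z).trans ε1
  have wb : ∀ z, |w z| ≤ 1 := fun z => abs_le.2 ⟨by linarith [w0 z], w1 z⟩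
  have W : ∀ C : ℝ → ℝ, Measurable C → (∀ x, |C x| ≤ 1) →
      ∫ z, C z.1 * (w z * (c - z.2)) ∂π = 0 := by
    intro C Cm Cb
    have m1 : Measurable (fun x => C x * r1 x) := by fun_prop
    have m2 : Measurable (fun x => C x * r2 x) := by fun_prop
    have b1 : ∀ x, |C x * r1 x| ≤ 1 := fun x => by
      rw [abs_mul, abs_of_nonneg (r10 x)]; exact mul_le_one₀ (Cb x) (r10 x) (r11 x)
    have b2 : ∀ x, |C x * r2 x| ≤ 1 := fun x => by
      rw [abs_mul, abs_of_nonneg (r20 x)]; exact mul_le_one₀ (Cb x) (r20 x) (r21 x)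
    have e1 := hp _ 1 m1 b1
    have e2 := hq _ 1 m2 b2
    have e3 : ∀ z : ℝ × ℝ, C z.1 * (w z * (c - z.2)) =
        ε * (C z.1 * r1 z.1 * (l z * (c - z.2)) - C z.1 * r2 z.1 * (u z * (z.2 - c))) := fun z => by
      simp only [hw]; ring
    simp only [e3]
    have q1 : Integrable (fun z : ℝ × ℝ => C z.1 * r1 z.1 * (l z * (c - z.2))) π :=
      int_bdd 1 if1 (m1.comp measurable_fst) (fun z => b1 _)
    have q2 : Integrable (fun z : ℝ × ℝ => C z.1 * r2 z.1 * (u z * (z.2 - c))) π :=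
      int_bdd 1 if2 (m2.comp measurable_fst) (fun z => b2 _)
    rw [integral_const_mul, integral_sub q1 q2, e1, e2]
    have : ∀ x, C x * r1 x * p x = C x * r2 x * q x := fun x => by
      rw [mul_assoc, r12, mul_assoc]
    simp [this]
  have iAw : Measurable (fun z => iA t z * w z) := (iA_meas t).mul wm
  have iAwb : ∀ z, |iA t z * w z| ≤ 1 := fun z => by
    rw [abs_mul]; exact mul_le_one₀ (iAb t z) (abs_nonneg _) (wb z)
  set M : ℝ := ∫ z, iA t z * w z ∂π with hM
  have iiAw : Integrable (fun z => iA t z * w z) π := by simpa using int_bdd 1 i1 iAw iAwb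
  have M0 : 0 ≤ M := integral_nonneg fun z => mul_nonneg (iA0 t z) (w0 z)
  have MT : M ≤ T := by
    refine le_trans ?_ εP
    rw [hM, hP, ← integral_const_mul]
    refine integral_mono iiAw (i1.const_mul ε) fun z => ?_
    simp only [mul_one]
    exact (mul_le_of_le_one_left (w0 z) (iA1 t z)).trans (wε z)
  set s : ℝ := M / T with hs
  have hsT : s * T = M := by rw [hs]; field_simp
  have s0 : 0 ≤ s := by positivity
  have s1 : s ≤ 1 := by rw [hs, div_le_one hTpos]; exact MT
  set g : ℝ × ℝ → ℝ := fun z => iA t z * (1 - w z) + s * iB z with hg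
  have iAm := iA_meas t
  have gm : Measurable g := by fun_prop
  have g0 : ∀ z, 0 ≤ g z := fun z =>
    add_nonneg (mul_nonneg (iA0 t z) (by linarith [w1 z])) (mul_nonneg s0 (iB0 z))
  have g1 : ∀ z, g z ≤ 1 := fun z => by
    simp only [hg, iBdef, iA]
    by_cases h : z.1 ≤ t
    · have : z ∉ B := fun h' => not_lt.2 h h'.1
      simp [h, this, w0 z]
    · simp only [h, if_false, zero_mul, zero_add]; split_ifs <;> simp [s1]
  -- integral formula
  have G : ∀ φ : ℝ × ℝ → ℝ, Integrable φ π → ∫ z, g z * φ z ∂π =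
      ∫ z, iA t z * φ z ∂π - ∫ z, iA t z * w z * φ z ∂π + s * ∫ z, iB z * φ z ∂π := by
    intro φ hφ
    have q1 : Integrable (fun z => iA t z * φ z - iA t z * w z * φ z) π :=
      (int_bdd 1 hφ (iA_meas t) (iAb t)).sub (int_bdd 1 hφ iAw iAwb)
    rw [← integral_const_mul, ← integral_sub (int_bdd 1 hφ (iA_meas t) (iAb t)) (int_bdd 1 hφ iAw iAwb),
      ← integral_add q1 ((int_bdd 1 hφ iBm iBb).const_mul s)]
    congr 1; ext z; simp only [hg]; ring
  have iApos : ∀ k, Integrable (fun z : ℝ × ℝ => max (z.2 - k) 0) π := fun k =>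
    (hY.sub (integrable_const k)).pos_part
  have iXpos : ∀ k, Integrable (fun z : ℝ × ℝ => max (z.1 - k) 0) π := fun k =>
    (hX.sub (integrable_const k)).pos_part
  have iAC : ∀ k, Measurable (fun x : ℝ => (if x ≤ t then (1:ℝ) else 0) * (if k < x then (1:ℝ) else 0)) := fun k =>
    (Measurable.ite measurableSet_Iic measurable_const measurable_const).mul
      (Measurable.ite measurableSet_Ioi measurable_const measurable_const)
  have K1 : ∫ z, g z ∂π = ∫ z, iA t z ∂π := by
    have := G (fun _ => 1) i1
    simp only [mul_one] at this
    rw [this, ← hM, ← hTdef, hsT]; ring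
  have WA : ∫ z, iA t z * w z * z.2 ∂π = c * M := by
    have h1 := W (fun x => if x ≤ t then 1 else 0)
      (Measurable.ite measurableSet_Iic measurable_const measurable_const)
      (fun x => by split_ifs <;> simp)
    have h2 : ∀ z : ℝ × ℝ, (if z.1 ≤ t then (1:ℝ) else 0) * (w z * (c - z.2)) =
        c * (iA t z * w z) - iA t z * w z * z.2 := fun z => by simp only [iA]; ring
    simp only [h2] at h1
    rw [integral_sub (iiAw.const_mul c) (int_bdd 1 hY iAw iAwb), integral_const_mul, ← hM] at h1
    linarith
  have K2 : ∫ z, g z * z.2 ∂π = ∫ z, iA t z * z.1 ∂π := by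
    rw [G _ hY, H1, WA, hcT, ← hsT]; ring
  have K3 : ∀ k, ∫ z, iA t z * max (z.1 - k) 0 ∂π ≤ ∫ z, g z * max (z.2 - k) 0 ∂π := by
    intro k
    rw [G _ (iApos k)]
    have j1 : T * max (c - k) 0 ≤ ∫ z, iB z * max (z.2 - k) 0 ∂π := by
      rcases le_total (c - k) 0 with h | h
      · rw [max_eq_right h, mul_zero]
        exact integral_nonneg fun z => mul_nonneg (iB0 z) (le_max_right _ _)
      · rw [max_eq_left h]
        have : T * (c - k) = ∫ z, (iB z * z.2 - k * iB z) ∂π := by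
          rw [integral_sub iiBY (iiB.const_mul k), integral_const_mul, hcT]; ring
        rw [this]
        refine integral_mono (iiBY.sub (iiB.const_mul k)) (int_bdd 1 (iApos k) iBm iBb) fun z => ?_
        have := mul_le_mul_of_nonneg_left (le_max_left (z.2 - k) 0) (iB0 z)
        simp only; linarith
    have j2 : M * max (c - k) 0 ≤ s * ∫ z, iB z * max (z.2 - k) 0 ∂π := by
      rw [← hsT, mul_assoc]; exact mul_le_mul_of_nonneg_left j1 s0
    set C : ℝ → ℝ := fun x => (if x ≤ t then (1:ℝ) else 0) * (if k < x then (1:ℝ) else 0) with hC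
    have Cb : ∀ x, |C x| ≤ 1 := fun x => by simp only [hC]; split_ifs <;> simp
    have CF : Measurable (fun z : ℝ × ℝ => C z.1) := (iAC k).comp measurable_fst
    have CFb : ∀ z : ℝ × ℝ, |C z.1| ≤ 1 := fun z => Cb _
    have j3 := W C (iAC k) Cb
    have iYX : Integrable (fun z : ℝ × ℝ => z.2 - z.1) π := hY.sub hX
    have HH : ∀ t, ∫ z, iA t z * (z.2 - z.1) ∂π = 0 := fun t => by
      simp only [mul_sub]
      rw [integral_sub (int_bdd 1 hY (iA_meas t) (iAb t)) (int_bdd 1 hX (iA_meas t) (iAb t)), H1, sub_self]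
    have j4 : ∫ z, C z.1 * (z.2 - z.1) ∂π = 0 := by
      rcases le_total t k with h | h
      · have : ∀ x, C x = 0 := fun x => by
          simp only [hC]; split_ifs <;> simp; linarith
        simp [this]
      · have : ∀ z : ℝ × ℝ, C z.1 * (z.2 - z.1) = iA t z * (z.2 - z.1) - iA k z * (z.2 - z.1) := fun z => by
          simp only [hC, iA]; split_ifs <;> simp <;> linarith
        simp only [this]
        rw [integral_sub (int_bdd 1 iYX (iA_meas t) (iAb t)) (int_bdd 1 iYX (iA_meas k) (iAb k)), HH, HH, sub_self]
    have n1 := int_bdd 1 (iXpos k) (iA_meas t) (iAb t)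
    have n2 := int_bdd 1 iYX CF CFb
    have n3 := int_bdd 1 (int_bdd 1 icY wm wb) CF CFb
    have n4 := int_bdd 1 (iApos k) (iA_meas t) (iAb t)
    have n5 := int_bdd 1 (iApos k) iAw iAwb
    have n6 := iiAw.mul_const (max (c - k) 0)
    have j5 : ∫ z, (iA t z * max (z.1 - k) 0 + C z.1 * (z.2 - z.1) + C z.1 * (w z * (c - z.2))) ∂π ≤
        ∫ z, (iA t z * max (z.2 - k) 0 - iA t z * w z * max (z.2 - k) 0
          + iA t z * w z * max (c - k) 0) ∂π := by
      refine integral_mono ((n1.add n2).add n3) ((n4.sub n5).add n6) fun z => ?_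
      simp only [iA, hC]
      by_cases h1 : z.1 ≤ t
      · have a1 := mul_le_mul_of_nonneg_left (le_max_left (c - k) 0) (w0 z)
        have a2 := mul_le_mul_of_nonneg_left (le_max_left (z.2 - k) 0) (sub_nonneg.2 (w1 z))
        have a3 := mul_nonneg (w0 z) (le_max_right (c - k) 0)
        have a4 := mul_nonneg (sub_nonneg.2 (w1 z)) (le_max_right (z.2 - k) 0)
        by_cases h2 : k < z.1
        · simp only [h1, h2, if_true, max_eq_left (sub_nonneg.2 h2.le)]
          nlinarith
        · simp only [h1, h2, if_true, if_false, max_eq_right (sub_nonpos.2 (not_lt.1 h2))]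
          nlinarith
      · simp [h1]
    have n12 : Integrable (fun z => iA t z * max (z.1 - k) 0 + C z.1 * (z.2 - z.1)) π := n1.add n2
    have n45 : Integrable (fun z => iA t z * max (z.2 - k) 0 - iA t z * w z * max (z.2 - k) 0) π :=
      n4.sub n5
    rw [integral_add n12 n3, integral_add n1 n2, integral_add n45 n6,
      integral_sub n4 n5, integral_mul_const, j3, j4, ← hM] at j5
    linarith
  have F := H2 g gm g0 g1 K1 K2 K3 b
  rw [G _ (iApos b)] at F
  have z1 : ∀ z : ℝ × ℝ, iB z * max (z.2 - b) 0 = 0 := fun z => by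
    rw [iBdef]; split_ifs with h
    · rw [max_eq_right (by linarith [h.2.2])]; simp
    · simp
  simp only [z1, integral_zero] at F
  have nn : ∀ z : ℝ × ℝ, 0 ≤ iA t z * w z * max (z.2 - b) 0 := fun z =>
    mul_nonneg (mul_nonneg (iA0 t z) (w0 z)) (le_max_right _ _)
  have F0 : ∫ z, iA t z * w z * max (z.2 - b) 0 ∂π = 0 :=
    le_antisymm (by linarith) (integral_nonneg nn)
  rw [integral_eq_zero_iff_of_nonneg nn (int_bdd 1 (iApos b) iAw iAwb)] at F0
  refine ⟨p, ?_⟩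
  filter_upwards [v1, v2, F0] with z h1 h2 h3
  refine ⟨fun hz hpz => ?_, fun hzt hzb => ?_⟩
  · have := h1 hpz
    simp only [hl, hz, if_true] at this
    linarith
  · by_contra hpz
    have hqz : q z.1 ≠ 0 := fun hqz => by
      have := h2 hqz
      simp only [hu, hzb, if_true] at this
      linarith
    have hpp : 0 < p z.1 := lt_of_le_of_ne (p0 _) (Ne.symm hpz)
    have : 0 < iA t z * w z * max (z.2 - b) 0 := by
      have e1 : iA t z = 1 := by simp [iA, hzt]
      have e2 : ¬ z.2 < a := by linarith
      have e3 : w z = ε * r2 z.1 := by simp [hw, hl, hu, hzb, e2]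
      have e4 : 0 < r2 z.1 := div_pos hpp (hden _)
      rw [e1, e3, max_eq_left (by linarith)]
      have : 0 < z.2 - b := by linarith
      positivity
    exact this.ne' h3

theorem leftCurtain_isLeftMonotone
    (μ ν : MeasureTheory.Measure ℝ)
    [MeasureTheory.IsFiniteMeasure μ] [MeasureTheory.IsFiniteMeasure ν]
    (hμ : MeasureTheory.Integrable (fun x : ℝ => x) μ)
    (hν : MeasureTheory.Integrable (fun x : ℝ => x) ν)
    (hord : ConvexOrder μ ν)
    (π : MeasureTheory.Measure (ℝ × ℝ))
    (hπ : IsLeftCurtain μ ν π) :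
    IsLeftMonotone π := by
  obtain ⟨⟨⟨m1, m2⟩, -⟩, hS⟩ := hπ
  have fin : IsFiniteMeasure π := by
    refine ⟨?_⟩
    have : π univ = μ univ := by rw [← m1, Measure.map_apply measurable_fst MeasurableSet.univ]; simp
    rw [this]; exact measure_lt_top _ _
  have hX : Integrable (fun z : ℝ × ℝ => z.1) π := by
    rw [← m1] at hμ; exact hμ.comp_measurable measurable_fst
  have hY : Integrable (fun z : ℝ × ℝ => z.2) π := by
    rw [← m2] at hν; exact hν.comp_measurable measurable_snd
  have Am : ∀ t : ℝ, MeasurableSet (Iic t ×ˢ (univ : Set ℝ)) := fun t => measurableSet_Iic.prod MeasurableSet.univ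
  have iAeq : ∀ (t : ℝ) (f : ℝ × ℝ → ℝ), ∫ z in Iic t ×ˢ (univ : Set ℝ), f z ∂π = ∫ z, iA t z * f z ∂π := by
    intro t f
    rw [← integral_indicator (Am t)]
    congr 1; ext z
    by_cases h : z.1 ≤ t <;> simp [Set.indicator, iA, h]
  have hSi : ∀ (t : ℝ) (φ : ℝ → ℝ), Measurable φ →
      ∫ y, φ y ∂(Measure.map Prod.snd (π.restrict ((Iic t) ×ˢ (univ : Set ℝ)))) = ∫ z, iA t z * φ z.2 ∂π := by
    intro t φ hφ
    rw [integral_map measurable_snd.aemeasurable hφ.aestronglyMeasurable, iAeq]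
  have hμi : ∀ (t : ℝ) (φ : ℝ → ℝ), Measurable φ →
      ∫ x, φ x ∂(μ.restrict (Iic t)) = ∫ z, iA t z * φ z.1 ∂π := by
    intro t φ hφ
    rw [← m1, Measure.restrict_map measurable_fst measurableSet_Iic,
      integral_map measurable_fst.aemeasurable hφ.aestronglyMeasurable, ← iAeq]
    congr 2; ext z; simp
  have maxm : ∀ k : ℝ, Measurable (fun x : ℝ => max (x - k) 0) := fun k => by fun_prop
  have H1 : ∀ t, ∫ z, iA t z * z.2 ∂π = ∫ z, iA t z * z.1 ∂π := by
    intro t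
    have := (hS t).2.1.2.1
    rw [hμi t (fun x => x) measurable_id, hSi t (fun x => x) measurable_id] at this
    exact this.symm
  have H2 : ∀ t, ∀ g : ℝ × ℝ → ℝ, Measurable g → (∀ z, 0 ≤ g z) → (∀ z, g z ≤ 1) →
      ∫ z, g z ∂π = ∫ z, iA t z ∂π → ∫ z, g z * z.2 ∂π = ∫ z, iA t z * z.1 ∂π →
      (∀ k, ∫ z, iA t z * max (z.1 - k) 0 ∂π ≤ ∫ z, g z * max (z.2 - k) 0 ∂π) →
      ∀ k, ∫ z, iA t z * max (z.2 - k) 0 ∂π ≤ ∫ z, g z * max (z.2 - k) 0 ∂π := by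
    intro t g gm g0 g1 k1 k2 k3 k
    set η : Measure ℝ := Measure.map Prod.snd (π.withDensity (fun z => ENNReal.ofReal (g z))) with hη
    have ηi : ∀ φ : ℝ → ℝ, Measurable φ → ∫ y, φ y ∂η = ∫ z, g z * φ z.2 ∂π := by
      intro φ hφ
      rw [hη, integral_map measurable_snd.aemeasurable hφ.aestronglyMeasurable,
        integral_withDensity_eq_integral_toReal_smul gm.ennreal_ofReal
          (Eventually.of_forall fun _ => ENNReal.ofReal_lt_top)]
      congr 1; ext z; rw [ENNReal.toReal_ofReal (g0 z), smul_eq_mul]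
    have ην : η ≤ ν := by
      rw [← m2, hη]
      refine Measure.map_mono ?_ measurable_snd
      calc π.withDensity (fun z => ENNReal.ofReal (g z)) ≤ π.withDensity 1 :=
            withDensity_mono (Eventually.of_forall fun z => by simpa using g1 z)
        _ = π := withDensity_one
    have ηf : IsFiniteMeasure η := isFiniteMeasure_of_le ν ην
    have co : ConvexOrder (μ.restrict (Iic t)) η := by
      refine ⟨?_, ?_, fun k => ?_⟩
      · have e1 := ηi (fun _ => 1) measurable_const
        have e2 := hμi t (fun _ => 1) measurable_const
        simp only [mul_one] at e1 e2
        rw [k1, ← e2] at e1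
        simp only [integral_const, smul_eq_mul, mul_one] at e1
        exact ((ENNReal.toReal_eq_toReal_iff' (measure_ne_top _ _) (measure_ne_top _ _)).1 e1).symm
      · rw [hμi t (fun x => x) measurable_id, ηi (fun x => x) measurable_id, k2]
      · rw [hμi t _ (maxm k), ηi _ (maxm k)]; exact k3 k
    have := ((hS t).2.2 η ην co).2.2 k
    rwa [hSi t _ (maxm k), ηi _ (maxm k)] at this
  have key : ∀ t a b : ℚ, ∃ p : ℝ → ℝ, ∃ Q : Prop, ∀ᵐ z ∂π, a < b →
      (Q → (t:ℝ) < z.1 → (a:ℝ) < z.2 → z.2 < (b:ℝ) → False) ∧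
      (¬ Q → (z.2 < (a:ℝ) → p z.1 ≠ 0) ∧ (z.1 ≤ (t:ℝ) → (b:ℝ) < z.2 → p z.1 = 0)) := by
    intro t a b
    by_cases hab : a < b
    swap
    · exact ⟨0, True, Eventually.of_forall fun z h => absurd h hab⟩
    by_cases hT : π (Ioi (t:ℝ) ×ˢ Ioo (a:ℝ) b) = 0
    · refine ⟨0, True, ?_⟩
      filter_upwards [measure_eq_zero_iff_ae_notMem.1 hT] with z hz _
      exact ⟨fun _ h1 h2 h3 => hz ⟨h1, h2, h3⟩, fun h => absurd trivial h⟩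
    · obtain ⟨p, hp⟩ := core π hX hY H1 t (H2 t) a b (by exact_mod_cast hab) hT
      refine ⟨p, False, ?_⟩
      filter_upwards [hp] with z hz _
      exact ⟨fun h => h.elim, fun _ => hz⟩
  choose p Q hp using key
  set G : Set (ℝ × ℝ) := {z | ∀ t a b : ℚ, a < b →
      (Q t a b → (t:ℝ) < z.1 → (a:ℝ) < z.2 → z.2 < (b:ℝ) → False) ∧
      (¬ Q t a b → (z.2 < (a:ℝ) → p t a b z.1 ≠ 0) ∧ (z.1 ≤ (t:ℝ) → (b:ℝ) < z.2 → p t a b z.1 = 0))} with hG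
  have all : ∀ᵐ z ∂π, z ∈ G := by
    simp only [hG, mem_setOf_eq]
    rw [ae_all_iff]; intro t
    rw [ae_all_iff]; intro a
    rw [ae_all_iff]; intro b
    exact hp t a b
  have hΓs : (toMeasurable π Gᶜ)ᶜ ⊆ G := compl_subset_comm.1 (subset_toMeasurable _ _)
  refine ⟨(toMeasurable π Gᶜ)ᶜ, (measurableSet_toMeasurable _ _).compl, ?_,
    fun x x' ym yp y' h1 h2 h3 hx hy1 hy2 => ?_⟩
  · rw [compl_compl, measure_toMeasurable]
    exact all
  obtain ⟨t, ht1, ht2⟩ := exists_rat_btwn hx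
  obtain ⟨a, ha1, ha2⟩ := exists_rat_btwn hy1
  obtain ⟨b, hb1, hb2⟩ := exists_rat_btwn hy2
  have hab : a < b := by exact_mod_cast ha2.trans hb1
  by_cases hQ : Q t a b
  · exact (hΓs h3 t a b hab).1 hQ ht2 ha2 hb1
  · exact ((hΓs h1 t a b hab).2 hQ).1 ha1 (((hΓs h2 t a b hab).2 hQ).2 ht1.le hb2)
end
end

section
/- Let π be a left-monotone martingale transport plan on ℝ×ℝ, with first marginal μ and second marginal ν. Then π is the left-curtain coupling: for every x ∈ ℝ the second marginal of the restriction of π to (−∞,x]×ℝ equals the shadow S^ν(μ|(−∞,x]) of the restriction of μ to (−∞,x] in ν. In particular, any two left-monotone elements of Π_M(μ,ν) coincide. -/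
open MeasureTheory Set Filter Topology

noncomputable section

theorem aux_int (μ : Measure ℝ) [IsFiniteMeasure μ] (h : Integrable (fun x : ℝ => x) μ) (k : ℝ) :
    Integrable (fun x : ℝ => max (x - k) 0) μ :=
  (h.sub (integrable_const k)).pos_part

theorem aux_kernel (μ ν : Measure ℝ) [IsFiniteMeasure μ] [IsFiniteMeasure ν]
    (hμ : Integrable (fun x : ℝ => x) μ) (hν : Integrable (fun x : ℝ => x) ν)
    (π : Measure (ℝ × ℝ)) (hπ : IsMartingaleCoupling μ ν π) :
    IsFiniteMeasure π ∧ ∃ κ : ProbabilityTheory.Kernel ℝ ℝ, ProbabilityTheory.IsMarkovKernel κ ∧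
      μ.compProd κ = π ∧ ∀ᵐ x ∂μ, Integrable (fun y : ℝ => y) (κ x) ∧ ∫ y, y ∂(κ x) = x := by
  obtain ⟨⟨h1, h2⟩, hm⟩ := hπ
  have hfin : IsFiniteMeasure π := by
    constructor
    have : π univ = μ univ := by
      rw [← h1, Measure.map_apply measurable_fst MeasurableSet.univ, preimage_univ]
    rw [this]; exact measure_lt_top _ _
  refine ⟨hfin, π.condKernel, inferInstance, ?_, ?_⟩
  · have := Measure.disintegrate π π.condKernel
    rwa [Measure.fst, h1] at this
  have hd : μ.compProd π.condKernel = π := by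
    have := Measure.disintegrate π π.condKernel
    rwa [Measure.fst, h1] at this
  set κ := π.condKernel
  have i1 : Integrable (fun p : ℝ × ℝ => p.1) π := by
    rw [← h1] at hμ
    exact hμ.comp_measurable measurable_fst
  have i2 : Integrable (fun p : ℝ × ℝ => p.2) π := by
    rw [← h2] at hν
    exact hν.comp_measurable measurable_snd
  have i2' := i2
  rw [← hd] at i2'
  have hii := ((Measure.integrable_compProd_iff i2'.aestronglyMeasurable).1 i2').1
  have hmi : Integrable (fun x => ∫ y, y ∂(κ x)) μ := MeasureTheory.Integrable.integral_compProd i2'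
  have key : ∀ᵐ x ∂μ, (∫ y, y ∂(κ x)) - x = 0 := by
    apply ae_eq_zero_of_integral_contDiff_smul_eq_zero (hmi.sub hμ).locallyIntegrable
    intro g hg hgs
    obtain ⟨C, hC⟩ := hgs.exists_bound_of_continuous hg.continuous
    have h0 := hm g hg.continuous ⟨C, fun x => by simpa using hC x⟩
    have hI : Integrable (fun p : ℝ × ℝ => g p.1 * (p.2 - p.1)) π := by
      refine (i2.sub i1).bdd_mul (c := C) ?_ (ae_of_all _ fun p => hC p.1)
      exact (hg.continuous.comp continuous_fst).aestronglyMeasurable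
    rw [← hd] at hI h0
    rw [Measure.integral_compProd hI] at h0
    rw [← h0]
    apply integral_congr_ae
    filter_upwards [hii] with x hx
    simp only [smul_eq_mul]
    rw [integral_const_mul, integral_sub hx (integrable_const _)]
    simp
  filter_upwards [hii, key] with x hx hk
  exact ⟨hx, by linarith⟩

/-- second marginal of the restriction -/
def sm (π : Measure (ℝ × ℝ)) (x : ℝ) : Measure ℝ :=
  Measure.map Prod.snd (π.restrict ((Set.Iic x) ×ˢ (Set.univ : Set ℝ)))

theorem sm_le (μ ν : Measure ℝ) (π : Measure (ℝ × ℝ)) (hπ : IsCoupling μ ν π) (x : ℝ) :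
    sm π x ≤ ν := by
  rw [← hπ.2]
  exact Measure.map_mono Measure.restrict_le_self measurable_snd

theorem sm_integral (μ ν : Measure ℝ) [IsFiniteMeasure μ] (π : Measure (ℝ × ℝ))
    (hπ : IsCoupling μ ν π) (κ : ProbabilityTheory.Kernel ℝ ℝ) [ProbabilityTheory.IsMarkovKernel κ]
    (hd : μ.compProd κ = π) (f : ℝ → ℝ) (hf : Integrable f ν) (x : ℝ) :
    Integrable (fun a => ∫ y, f y ∂(κ a)) (μ.restrict (Iic x)) ∧
    ∫ y, f y ∂(sm π x) = ∫ a in Iic x, ∫ y, f y ∂(κ a) ∂μ := by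
  have hf' : Integrable (fun p : ℝ × ℝ => f p.2) π := by
    rw [← hπ.2] at hf
    exact hf.comp_measurable measurable_snd
  have hfs : Integrable f (sm π x) := hf.mono_measure (sm_le μ ν π hπ x)
  constructor
  · rw [← hd] at hf'
    exact (MeasureTheory.Integrable.integral_compProd hf' : Integrable (fun a => ∫ y, f y ∂(κ a)) μ).restrict
  · rw [sm, integral_map measurable_snd.aemeasurable hfs.aestronglyMeasurable]
    rw [← hd] at hf' ⊢
    rw [Measure.setIntegral_compProd measurableSet_Iic MeasurableSet.univ hf'.integrableOn]
    simp

theorem sm_convex (μ ν : Measure ℝ) [IsFiniteMeasure μ] [IsFiniteMeasure ν]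
    (hμ : Integrable (fun x : ℝ => x) μ) (hν : Integrable (fun x : ℝ => x) ν)
    (π : Measure (ℝ × ℝ)) (hπ : IsMartingaleCoupling μ ν π) (x : ℝ) :
    ConvexOrder (μ.restrict (Iic x)) (sm π x) := by
  obtain ⟨hfin, κ, hκ, hd, hm⟩ := aux_kernel μ ν hμ hν π hπ
  have hm' := ae_restrict_of_ae (s := Iic x) hm
  refine ⟨?_, ?_, ?_⟩
  · rw [sm, Measure.map_apply measurable_snd MeasurableSet.univ, ← hπ.1.1]
    rw [Measure.restrict_apply MeasurableSet.univ, Measure.map_apply measurable_fst (by measurability),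
      preimage_univ, Measure.restrict_apply MeasurableSet.univ]
    congr 1
    ext p; simp
  · rw [(sm_integral μ ν π hπ.1 κ hd _ hν x).2]
    apply integral_congr_ae
    filter_upwards [hm'] with a ha
    exact ha.2.symm
  · intro k
    obtain ⟨hi, he⟩ := sm_integral μ ν π hπ.1 κ hd _ (aux_int ν hν k) x
    rw [he]
    apply integral_mono_ae (aux_int μ hμ k).restrict hi
    filter_upwards [hm'] with a ha
    apply max_le
    · calc a - k = ∫ y, (y - k) ∂(κ a) := by
            rw [integral_sub ha.1 (integrable_const _), ha.2]; simp
        _ ≤ _ := integral_mono (ha.1.sub (integrable_const _)) (aux_int _ ha.1 k) (fun y => le_max_left _ _)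
    · exact integral_nonneg fun y => le_max_right _ _

theorem sm_shadow (μ ν : Measure ℝ) [IsFiniteMeasure μ] [IsFiniteMeasure ν]
    (hμ : Integrable (fun x : ℝ => x) μ) (hν : Integrable (fun x : ℝ => x) ν)
    (π : Measure (ℝ × ℝ)) (hπ : IsMartingaleCoupling μ ν π) (hmono : IsLeftMonotone π) (x : ℝ) :
    IsShadow (μ.restrict (Iic x)) ν (sm π x) := by
  have hc := sm_convex μ ν hμ hν π hπ x
  refine ⟨sm_le μ ν π hπ.1 x, hc, ?_⟩
  intro η hη hcη
  refine ⟨hc.1.symm.trans hcη.1, hc.2.1.symm.trans hcη.2.1, ?_⟩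
  obtain ⟨hfin, κ, hκ, hd, hm⟩ := aux_kernel μ ν hμ hν π hπ
  obtain ⟨Γ, hΓm, hΓ, hmon⟩ := hmono
  have hSle := sm_le μ ν π hπ.1 x
  have : IsFiniteMeasure η := isFiniteMeasure_of_le ν hη
  have : IsFiniteMeasure (sm π x) := isFiniteMeasure_of_le ν hSle
  have hηi : Integrable (fun x : ℝ => x) η := hν.mono_measure hη
  have hSi : Integrable (fun x : ℝ => x) (sm π x) := hν.mono_measure hSle
  have hΓκ : ∀ᵐ a ∂μ, ∀ᵐ y ∂(κ a), (a, y) ∈ Γ := by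
    apply Measure.ae_ae_of_ae_compProd (p := fun p => p ∈ Γ)
    rw [hd]; exact hΓ
  set U : Set ℝ := {y | ∃ a ym yp, a ≤ x ∧ (a, ym) ∈ Γ ∧ (a, yp) ∈ Γ ∧ ym < y ∧ y < yp} with hU
  have hUo : IsOpen U := by
    have : U = ⋃ (t : {t : ℝ × ℝ × ℝ // t.1 ≤ x ∧ (t.1, t.2.1) ∈ Γ ∧ (t.1, t.2.2) ∈ Γ}),
        Ioo t.1.2.1 t.1.2.2 := by
      ext y
      simp only [hU, mem_ofPred_eq, mem_iUnion, mem_Ioo]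
      constructor
      · rintro ⟨a, ym, yp, h1, h2, h3, h4, h5⟩
        exact ⟨⟨(a, ym, yp), h1, h2, h3⟩, h4, h5⟩
      · rintro ⟨⟨⟨a, ym, yp⟩, h1, h2, h3⟩, h4, h5⟩
        exact ⟨a, ym, yp, h1, h2, h3, h4, h5⟩
    rw [this]
    exact isOpen_iUnion fun t => isOpen_Ioo
  have hFc : IsClosed Uᶜ := hUo.isClosed_compl
  -- on U the two measures agree
  have hres : ν.restrict U = (sm π x).restrict U := by
    ext s hs
    have hsU := hs.inter hUo.measurableSet
    rw [Measure.restrict_apply hs, Measure.restrict_apply hs, sm, ← hπ.1.2,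
      Measure.map_apply measurable_snd hsU, Measure.map_apply measurable_snd hsU,
      Measure.restrict_apply (measurable_snd hsU)]
    apply measure_congr
    have : ∀ᵐ p ∂π, p ∈ Γ := hΓ
    filter_upwards [this] with p hp
    apply propext
    constructor
    · intro h
      refine ⟨h, ?_, trivial⟩
      by_contra hlt
      obtain ⟨a, ym, yp, h1, h2, h3, h4, h5⟩ := h.2
      exact hmon a p.1 ym yp p.2 h2 h3 hp (lt_of_le_of_lt h1 (not_le.1 hlt)) h4 h5
    · intro h
      exact h.1
  -- points outside U
  have hF : ∀ k, k ∉ U → (∫ y, max (y - k) 0 ∂(sm π x)) ≤ ∫ y, max (y - k) 0 ∂η := by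
    intro k hk
    refine le_trans (le_of_eq ?_) (hcη.2.2 k)
    rw [(sm_integral μ ν π hπ.1 κ hd _ (aux_int ν hν k) x).2]
    apply integral_congr_ae
    filter_upwards [ae_restrict_of_ae (s := Iic x) hm, ae_restrict_of_ae (s := Iic x) hΓκ,
      ae_restrict_mem measurableSet_Iic] with a ha hg hax
    have e1 : ∫ y, (y - k) ∂(κ a) = a - k := by
      rw [integral_sub ha.1 (integrable_const _), ha.2]; simp
    by_cases hside : ∃ y, (a, y) ∈ Γ ∧ y < k
    · obtain ⟨y0, hy0, hy0k⟩ := hside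
      have hle : ∀ᵐ y ∂(κ a), y - k ≤ 0 := by
        filter_upwards [hg] with y hy
        by_contra hlt
        exact hk ⟨a, y0, y, hax, hy0, hy, hy0k, by linarith⟩
      have e2 : ∫ y, max (y - k) 0 ∂(κ a) = 0 := by
        apply integral_eq_zero_of_ae
        filter_upwards [hle] with y hy
        exact max_eq_right hy
      have e3 : ∫ y, (y - k) ∂(κ a) ≤ 0 := integral_nonpos_of_ae hle
      rw [e2, max_eq_right (by linarith)]
    · push Not at hside
      have hge : ∀ᵐ y ∂(κ a), 0 ≤ y - k := by
        filter_upwards [hg] with y hy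
        linarith [hside y hy]
      have e2 : ∫ y, max (y - k) 0 ∂(κ a) = ∫ y, (y - k) ∂(κ a) := by
        apply integral_congr_ae
        filter_upwards [hge] with y hy
        exact max_eq_left hy
      have e3 : 0 ≤ ∫ y, (y - k) ∂(κ a) := integral_nonneg_of_ae hge
      rw [e2, e1, max_eq_left (by linarith)]
  -- comparison
  have hcmp : ∀ (k : ℝ) (g : ℝ → ℝ), Integrable g ν → (∀ y, max (y - k) 0 ≤ g y) →
      (∀ y, y ∉ U → g y = max (y - k) 0) → (∫ y, g y ∂(sm π x)) ≤ ∫ y, g y ∂η →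
      (∫ y, max (y - k) 0 ∂(sm π x)) ≤ ∫ y, max (y - k) 0 ∂η := by
    intro k g hg hge heq hle
    have hhi : Integrable (fun y => g y - max (y - k) 0) ν := hg.sub (aux_int ν hν k)
    have hz : ∀ ρ : Measure ℝ, ∫ y, (g y - max (y - k) 0) ∂ρ = ∫ y in U, (g y - max (y - k) 0) ∂ρ := by
      intro ρ
      rw [setIntegral_eq_integral_of_forall_compl_eq_zero]
      intro y hy
      rw [heq y hy, sub_self]
    have h1 : ∫ y, (g y - max (y - k) 0) ∂η ≤ ∫ y, (g y - max (y - k) 0) ∂(sm π x) := by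
      rw [hz η, hz (sm π x), ← hres]
      exact integral_mono_measure (Measure.restrict_mono le_rfl hη)
        (ae_of_all _ fun y => sub_nonneg.2 (hge y)) hhi.restrict
    rw [integral_sub (hg.mono_measure hη) (aux_int η hηi k),
      integral_sub (hg.mono_measure hSle) (aux_int _ hSi k)] at h1
    linarith
  intro k
  by_cases hk : k ∈ U
  swap
  · exact hF k hk
  by_cases hA : (Uᶜ ∩ Iic k).Nonempty <;> by_cases hB : (Uᶜ ∩ Ici k).Nonempty
  · obtain ⟨ha1, ha2⟩ := (hFc.inter isClosed_Iic).csSup_mem hA ⟨k, fun y hy => hy.2⟩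
    obtain ⟨hb1, hb2⟩ := (hFc.inter isClosed_Ici).csInf_mem hB ⟨k, fun y hy => hy.2⟩
    have ha3 : ∀ y, y ∉ U → y ≤ k → y ≤ sSup (Uᶜ ∩ Iic k) := fun y h1 h2 =>
      le_csSup ⟨k, fun y hy => hy.2⟩ ⟨h1, h2⟩
    have hb3 : ∀ y, y ∉ U → k ≤ y → sInf (Uᶜ ∩ Ici k) ≤ y := fun y h1 h2 =>
      csInf_le ⟨k, fun y hy => hy.2⟩ ⟨h1, h2⟩
    generalize sSup (Uᶜ ∩ Iic k) = a at *
    generalize sInf (Uᶜ ∩ Ici k) = b at *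
    have hak : a < k := lt_of_le_of_ne ha2 (fun h => ha1 (h ▸ hk))
    have hkb : k < b := lt_of_le_of_ne hb2 (fun h => hb1 (h ▸ hk))
    have hab : 0 < b - a := by linarith
    set s := (b - k) / (b - a) with hs
    set t := (k - a) / (b - a) with ht
    have hs0 : 0 ≤ s := div_nonneg (by linarith) hab.le
    have ht0 : 0 ≤ t := div_nonneg (by linarith) hab.le
    have hst : s + t = 1 := by rw [hs, ht]; field_simp; ring
    have hst2 : s * a + t * b = k := by rw [hs, ht]; field_simp; ring
    apply hcmp k (fun y => s * max (y - a) 0 + t * max (y - b) 0)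
    · exact ((aux_int ν hν a).const_mul s).add ((aux_int ν hν b).const_mul t)
    · intro y
      have h1 := mul_le_mul_of_nonneg_left (le_max_left (y - a) 0) hs0
      have h2 := mul_le_mul_of_nonneg_left (le_max_left (y - b) 0) ht0
      have h3 : y = s * y + t * y := by rw [← add_mul, hst, one_mul]
      apply max_le
      · show _ ≤ s * max (y - a) 0 + t * max (y - b) 0
        linarith
      · positivity
    · intro y hy
      rcases le_total y k with h | h
      · have := ha3 y hy h
        show s * max (y - a) 0 + t * max (y - b) 0 = _
        rw [max_eq_right (by linarith), max_eq_right (by linarith), max_eq_right (by linarith)]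
        ring
      · have := hb3 y hy h
        have h3 : y = s * y + t * y := by rw [← add_mul, hst, one_mul]
        show s * max (y - a) 0 + t * max (y - b) 0 = _
        rw [max_eq_left (by linarith), max_eq_left (by linarith), max_eq_left (by linarith)]
        linarith
    · rw [integral_add ((aux_int _ hSi a).const_mul s) ((aux_int _ hSi b).const_mul t),
        integral_add ((aux_int _ hηi a).const_mul s) ((aux_int _ hηi b).const_mul t),
        integral_const_mul, integral_const_mul, integral_const_mul, integral_const_mul]
      exact add_le_add (mul_le_mul_of_nonneg_left (hF a ha1) hs0)
        (mul_le_mul_of_nonneg_left (hF b hb1) ht0)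
  · obtain ⟨ha1, ha2⟩ := (hFc.inter isClosed_Iic).csSup_mem hA ⟨k, fun y hy => hy.2⟩
    have ha3 : ∀ y, y ∉ U → y ≤ k → y ≤ sSup (Uᶜ ∩ Iic k) := fun y h1 h2 =>
      le_csSup ⟨k, fun y hy => hy.2⟩ ⟨h1, h2⟩
    generalize sSup (Uᶜ ∩ Iic k) = a at *
    have ha2 : a ≤ k := ha2
    apply hcmp k (fun y => max (y - a) 0) (aux_int ν hν a)
    · intro y
      exact max_le_max (by linarith) le_rfl
    · intro y hy
      rcases le_total y k with h | h
      · have := ha3 y hy h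
        show max (y - a) 0 = _
        rw [max_eq_right (by linarith), max_eq_right (by linarith)]
      · exact absurd ⟨y, hy, h⟩ hB
    · exact hF a ha1
  · obtain ⟨hb1, hb2⟩ := (hFc.inter isClosed_Ici).csInf_mem hB ⟨k, fun y hy => hy.2⟩
    have hb3 : ∀ y, y ∉ U → k ≤ y → sInf (Uᶜ ∩ Ici k) ≤ y := fun y h1 h2 =>
      csInf_le ⟨k, fun y hy => hy.2⟩ ⟨h1, h2⟩
    generalize sInf (Uᶜ ∩ Ici k) = b at *
    have hb2 : k ≤ b := hb2
    apply hcmp k (fun y => (b - k) + max (y - b) 0) ((integrable_const _).add (aux_int ν hν b))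
    · intro y
      apply max_le
      · show _ ≤ (b - k) + max (y - b) 0
        linarith [le_max_left (y - b) 0]
      · show _ ≤ (b - k) + max (y - b) 0
        linarith [le_max_right (y - b) 0]
    · intro y hy
      rcases le_total y k with h | h
      · exact absurd ⟨y, hy, h⟩ hA
      · have := hb3 y hy h
        show (b - k) + max (y - b) 0 = _
        rw [max_eq_left (by linarith), max_eq_left (by linarith)]
        ring
    · rw [integral_add (integrable_const _) (aux_int _ hSi b),
        integral_add (integrable_const _) (aux_int _ hηi b), integral_const, integral_const,
        measureReal_def, measureReal_def, ← hc.1, ← hcη.1]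
      exact add_le_add le_rfl (hF b hb1)
  · have hall : U = univ := by
      apply eq_univ_of_forall
      intro y
      by_contra hy
      rcases le_total y k with h | h
      · exact hA ⟨y, hy, h⟩
      · exact hB ⟨y, hy, h⟩
    rw [hall, Measure.restrict_univ, Measure.restrict_univ] at hres
    rw [← hres] at hc ⊢
    rw [Measure.eq_of_le_of_measure_univ_eq hη (hcη.1.symm.trans hc.1)]

theorem call_ext (μ ν : Measure ℝ) [IsFiniteMeasure μ] [IsFiniteMeasure ν]
    (hμ : Integrable (fun x : ℝ => x) μ) (hν : Integrable (fun x : ℝ => x) ν)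
    (h : ∀ k : ℝ, (∫ x, max (x - k) 0 ∂μ) = ∫ x, max (x - k) 0 ∂ν) : μ = ν := by
  apply Measure.ext_of_Ici
  intro k
  let f : ℕ → ℝ → ℝ := fun n y =>
    ((n : ℝ) + 1) * (max (y - (k - 1 / ((n : ℝ) + 1))) 0 - max (y - k) 0)
  have lim : ∀ y, Tendsto (fun n => f n y) atTop (𝓝 ((Ici k).indicator (fun _ => (1 : ℝ)) y)) := by
    intro y
    by_cases hy : k ≤ y
    · rw [indicator_of_mem (show y ∈ Ici k from hy)]
      apply tendsto_const_nhds.congr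
      intro n
      have hn : (0 : ℝ) < (n : ℝ) + 1 := by positivity
      have : 0 < 1 / ((n : ℝ) + 1) := by positivity
      simp only [f]
      rw [max_eq_left (by linarith), max_eq_left (by linarith)]
      field_simp
      ring
    · rw [indicator_of_notMem (show y ∉ Ici k from hy)]
      push Not at hy
      apply tendsto_const_nhds.congr'
      have h1 := (tendsto_one_div_add_atTop_nhds_zero_nat (𝕜 := ℝ)).eventually_lt_const
        (sub_pos.2 hy)
      filter_upwards [h1] with n hn
      simp only [f]
      rw [max_eq_right (by linarith), max_eq_right (by linarith)]
      simp
  have main : ∀ ρ : Measure ℝ, IsFiniteMeasure ρ →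
      Tendsto (fun n => ∫ y, f n y ∂ρ) atTop (𝓝 (ρ.real (Ici k))) := by
    intro ρ hρ
    have : ρ.real (Ici k) = ∫ y, (Ici k).indicator (fun _ => (1 : ℝ)) y ∂ρ := by
      rw [integral_indicator measurableSet_Ici]; simp
    rw [this]
    apply tendsto_integral_of_dominated_convergence (fun _ => (1 : ℝ))
    · intro n
      exact Continuous.aestronglyMeasurable (by fun_prop)
    · exact integrable_const _
    · intro n
      refine ae_of_all _ fun y => ?_
      have hn : (0 : ℝ) < (n : ℝ) + 1 := by positivity
      have hp : 0 < 1 / ((n : ℝ) + 1) := by positivity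
      have hq : ((n : ℝ) + 1) * (1 / ((n : ℝ) + 1)) = 1 := by field_simp
      have hl : 0 ≤ max (y - (k - 1 / ((n : ℝ) + 1))) 0 - max (y - k) 0 :=
        sub_nonneg.2 (max_le_max (by linarith) le_rfl)
      have hu : max (y - (k - 1 / ((n : ℝ) + 1))) 0 - max (y - k) 0 ≤ 1 / ((n : ℝ) + 1) := by
        have := le_max_left (y - k) 0
        have := le_max_right (y - k) 0
        rw [sub_le_iff_le_add]
        apply max_le <;> linarith
      rw [Real.norm_of_nonneg (mul_nonneg hn.le hl)]
      exact (mul_le_mul_of_nonneg_left hu hn.le).trans hq.le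
    · exact ae_of_all _ lim
  have heq : ∀ n, ∫ y, f n y ∂μ = ∫ y, f n y ∂ν := by
    intro n
    simp only [f]
    rw [integral_const_mul, integral_const_mul, integral_sub (aux_int μ hμ _) (aux_int μ hμ _),
      integral_sub (aux_int ν hν _) (aux_int ν hν _), h, h]
  have m1 := main μ inferInstance
  simp only [heq] at m1
  have := tendsto_nhds_unique m1 (main ν inferInstance)
  exact (measureReal_eq_measureReal_iff).1 this

/-- a left-monotone martingale coupling is the left-curtain coupling;
in particular any two left-monotone elements of `Π_M(μ,ν)` coincide. -/
theorem leftMonotone_is_leftCurtain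
    (μ ν : MeasureTheory.Measure ℝ)
    [MeasureTheory.IsFiniteMeasure μ] [MeasureTheory.IsFiniteMeasure ν]
    (hμ : MeasureTheory.Integrable (fun x : ℝ => x) μ)
    (hν : MeasureTheory.Integrable (fun x : ℝ => x) ν)
    (π : MeasureTheory.Measure (ℝ × ℝ))
    (hπ : IsMartingaleCoupling μ ν π)
    (hmono : IsLeftMonotone π) :
    (∀ x : ℝ, IsShadow (μ.restrict (Set.Iic x)) ν
      (MeasureTheory.Measure.map Prod.snd (π.restrict ((Set.Iic x) ×ˢ (Set.univ : Set ℝ))))) ∧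
    ∀ π' : MeasureTheory.Measure (ℝ × ℝ),
      IsMartingaleCoupling μ ν π' → IsLeftMonotone π' → π' = π := by
  refine ⟨fun x => sm_shadow μ ν hμ hν π hπ hmono x, ?_⟩
  intro π' hπ' hmono'
  have hfin := (aux_kernel μ ν hμ hν π hπ).1
  have hfin' := (aux_kernel μ ν hμ hν π' hπ').1
  have hS : ∀ x, sm π' x = sm π x := by
    intro x
    have s1 := sm_shadow μ ν hμ hν π hπ hmono x
    have s2 := sm_shadow μ ν hμ hν π' hπ' hmono' x
    have : IsFiniteMeasure (sm π x) := isFiniteMeasure_of_le ν s1.1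
    have : IsFiniteMeasure (sm π' x) := isFiniteMeasure_of_le ν s2.1
    apply call_ext _ _ (hν.mono_measure s2.1) (hν.mono_measure s1.1)
    intro k
    exact le_antisymm ((s2.2.2 _ s1.1 s1.2.1).2.2 k) ((s1.2.2 _ s2.1 s2.2.1).2.2 k)
  rw [Measure.ext_prod_iff]
  intro s t hs ht
  have hmap : (π'.restrict (univ ×ˢ t)).map Prod.fst = (π.restrict (univ ×ˢ t)).map Prod.fst := by
    apply Measure.ext_of_Iic
    intro x
    have h := congrArg (fun m : Measure ℝ => m t) (hS x)
    simp only [sm] at h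
    rw [Measure.map_apply measurable_snd ht, Measure.map_apply measurable_snd ht,
      Measure.restrict_apply (measurable_snd ht), Measure.restrict_apply (measurable_snd ht)] at h
    rw [Measure.map_apply measurable_fst measurableSet_Iic,
      Measure.map_apply measurable_fst measurableSet_Iic,
      Measure.restrict_apply (measurable_fst measurableSet_Iic),
      Measure.restrict_apply (measurable_fst measurableSet_Iic)]
    have e : (Prod.fst ⁻¹' Iic x ∩ univ ×ˢ t : Set (ℝ × ℝ)) = Prod.snd ⁻¹' t ∩ Iic x ×ˢ univ := by
      ext p; simp [and_comm]
    rw [e, h]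
  have h := congrArg (fun m : Measure ℝ => m s) hmap
  beta_reduce at h
  rw [Measure.map_apply measurable_fst hs, Measure.map_apply measurable_fst hs,
    Measure.restrict_apply (measurable_fst hs), Measure.restrict_apply (measurable_fst hs)] at h
  have e : (Prod.fst ⁻¹' s ∩ univ ×ˢ t : Set (ℝ × ℝ)) = s ×ˢ t := by
    ext p; simp
  rwa [e] at h
end
end
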